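/- arXiv:0802.1082 — 3 statements merged into one kernel-verified Lean document; each statement's English description precedes it below -/
import Mathlib

section
/- Every indecomposable Eisenstein root lattice (a positive-definite E-lattice L with ⟨L,L⟩ ⊆ θE spanned by its vectors of norm 3) is isometric to one of: A₂^E = θE; D₄^E = {(x,x,y) ∈ E³ : x ≡ y mod θ}; E₆^E = {(x,y,z) ∈ E³ : x ≡ y ≡ z mod θ}; or E₈^E = {x ∈ E⁴ : x mod θ ∈ C₄} with C₄ the tetracode. -/
noncomputable section

def ω : ℂ := -1/2 + (Real.sqrt 3 / 2) * Complex.I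
def θ : ℂ := ω - (starRingEnd ℂ) ω
def Eis : Subring ℂ := Subring.closure {ω}

/-- The standard Hermitian form on `ℂ^k`. -/
def hermF {k : ℕ} (x y : Fin k → ℂ) : ℂ := ∑ i, x i * (starRingEnd ℂ) (y i)

/-- `A₂^E = θ·Eis ⊆ ℂ¹`. -/
def A2L : Set (Fin 1 → ℂ) := {x | ∃ e ∈ Eis, x 0 = θ * e}

/-- `D₄^E = {(x,x,y) ∈ Eis³ : x ≡ y mod θ}`. -/
def D4L : Set (Fin 3 → ℂ) :=
  {x | (∀ i, x i ∈ Eis) ∧ x 0 = x 1 ∧ ∃ e ∈ Eis, x 0 - x 2 = θ * e}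

/-- `E₆^E = {(x,y,z) ∈ Eis³ : x ≡ y ≡ z mod θ}`. -/
def E6L : Set (Fin 3 → ℂ) :=
  {x | (∀ i, x i ∈ Eis) ∧ (∃ e ∈ Eis, x 0 - x 1 = θ * e) ∧ ∃ e ∈ Eis, x 1 - x 2 = θ * e}

/-- The tetracode `C₄ ⊆ 𝔽₃⁴`. -/
def tetracode : Submodule (ZMod 3) (Fin 4 → ZMod 3) :=
  Submodule.span (ZMod 3) {![0, 1, 1, 1], ![1, 0, 1, -1]}

/-- `E₈^E = {x ∈ Eis⁴ : x mod θ ∈ C₄}`. -/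
def E8L : Set (Fin 4 → ℂ) :=
  {x | (∀ i, x i ∈ Eis) ∧
    ∃ c ∈ tetracode, ∀ i, ∃ e ∈ Eis, x i - ((c i).val : ℂ) = θ * e}

/-- Isometry of Eisenstein lattices sitting in standard Hermitian spaces. -/
def LatIsom {n m : ℕ} (L : Set (Fin n → ℂ)) (M : Set (Fin m → ℂ)) : Prop :=
  ∃ f : (Fin n → ℂ) → (Fin m → ℂ),
    Set.BijOn f L M ∧
    (∀ x ∈ L, ∀ y ∈ L, f (x + y) = f x + f y) ∧
    (∀ x ∈ L, f (ω • x) = ω • f x) ∧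
    ∀ x ∈ L, ∀ y ∈ L, hermF (f x) (f y) = hermF x y

open ComplexConjugate

lemma omega_sq : ω * ω = -1 - ω := by
  have h : ((Real.sqrt 3 : ℝ) : ℂ) * (Real.sqrt 3 : ℝ) = 3 := by
    rw [← Complex.ofReal_mul, Real.mul_self_sqrt (by norm_num)]; norm_num
  unfold ω
  linear_combination (1 / 4 * Complex.I * Complex.I) * h + 3 / 4 * Complex.I_mul_I

lemma conj_omega : conj ω = -1 - ω := by
  simp only [ω, map_add, map_mul, map_div₀, map_neg, map_one, map_ofNat, Complex.conj_ofReal,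
    Complex.conj_I]
  ring

lemma theta_eq : θ = 1 + 2 * ω := by
  rw [θ, conj_omega]; ring

lemma theta_sq : θ * θ = -3 := by
  rw [theta_eq]; linear_combination 4 * omega_sq

lemma conj_theta : conj θ = -θ := by
  simp [θ]

lemma theta_ne_zero : θ ≠ 0 := fun h ↦ by
  simpa [h] using theta_sq

lemma omega_mem : ω ∈ Eis := Subring.subset_closure rfl

lemma theta_mem : θ ∈ Eis := by
  rw [theta_eq, two_mul]
  exact add_mem (one_mem _) (add_mem omega_mem omega_mem)

lemma mem_Eis_iff {e : ℂ} : e ∈ Eis ↔ ∃ a b : ℤ, e = a + b * ω := by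
  constructor
  · intro h
    induction h using Subring.closure_induction with
    | mem x hx => exact ⟨0, 1, by simpa using hx⟩
    | zero => exact ⟨0, 0, by simp⟩
    | one => exact ⟨1, 0, by simp⟩
    | add x y _ _ hx hy =>
      obtain ⟨a, b, rfl⟩ := hx
      obtain ⟨c, d, rfl⟩ := hy
      exact ⟨a + c, b + d, by push_cast; ring⟩
    | neg x _ hx =>
      obtain ⟨a, b, rfl⟩ := hx
      exact ⟨-a, -b, by push_cast; ring⟩
    | mul x y _ _ hx hy =>
      obtain ⟨a, b, rfl⟩ := hx
      obtain ⟨c, d, rfl⟩ := hy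
      exact ⟨a * c - b * d, a * d + b * c - b * d, by
        push_cast; linear_combination (b * d : ℂ) * omega_sq⟩
  · rintro ⟨a, b, rfl⟩
    exact add_mem (intCast_mem _ _) (mul_mem (intCast_mem _ _) omega_mem)

lemma conj_mem_Eis {e : ℂ} (h : e ∈ Eis) : conj e ∈ Eis := by
  obtain ⟨a, b, rfl⟩ := mem_Eis_iff.1 h
  exact mem_Eis_iff.2 ⟨a - b, -b, by simp [conj_omega]; ring⟩

/-- A real multiple of `θ` in the Eisenstein integers is an integer multiple of `3`. -/
lemma theta_mul_eq_of_real {e : ℂ} (he : e ∈ Eis) {t : ℝ} (h : (t : ℂ) = θ * e) :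
    ∃ z : ℤ, t = 3 * z := by
  obtain ⟨a, b, rfl⟩ := mem_Eis_iff.1 he
  refine ⟨-a, ?_⟩
  have h1 := congrArg conj h
  simp only [Complex.conj_ofReal, map_mul, conj_theta, map_add, map_intCast, conj_omega] at h1
  have h2 : θ * (2 * a - b) = 0 := by linear_combination h1 - h
  have h3 : (b : ℂ) = 2 * a := by
    rcases mul_eq_zero.1 h2 with h2 | h2
    · exact absurd h2 theta_ne_zero
    · linear_combination -h2
  have h4 : (t : ℂ) = ((3 * (-a : ℤ) : ℝ) : ℂ) := by
    rw [h, h3]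
    push_cast
    have := theta_sq
    linear_combination a * this - a * θ * theta_eq
  exact_mod_cast h4

/-- Every Eisenstein integer is congruent to a rational integer modulo `θ`. -/
lemma exists_int_residue_theta {e : ℂ} (he : e ∈ Eis) : ∃ z : ℤ, ∃ t ∈ Eis, e - z = θ * t := by
  obtain ⟨a, b, rfl⟩ := mem_Eis_iff.1 he
  refine ⟨a + b, b * (1 + ω), mul_mem (intCast_mem _ _) (add_mem (one_mem _) omega_mem), ?_⟩
  rw [theta_eq]
  push_cast
  linear_combination (-2 * b : ℂ) * omega_sq

lemma int_sub_val_dvd (z : ℤ) : ∃ t ∈ Eis, (z : ℂ) - ((z : ZMod 3).val : ℂ) = θ * t := by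
  obtain ⟨q, hq⟩ : (3 : ℤ) ∣ z - (z : ZMod 3).val := by
    rw [← Nat.cast_ofNat, ← ZMod.intCast_eq_intCast_iff_dvd_sub]
    simp
  have hq' : (z : ℂ) - ((z : ZMod 3).val : ℂ) = 3 * q := by exact_mod_cast hq
  exact ⟨-θ * q, mul_mem (neg_mem theta_mem) (intCast_mem _ _), by
    linear_combination hq' + q * theta_sq⟩

/-- Every Eisenstein integer is congruent to `0`, `1` or `-1` modulo `θ`. -/
lemma exists_residue_theta {e : ℂ} (he : e ∈ Eis) :
    ∃ t ∈ Eis, ∃ ρ ∈ Eis, (ρ = 0 ∨ ρ * conj ρ = 1) ∧ e = θ * t + ρ := by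
  obtain ⟨z, t, ht, h⟩ := exists_int_residue_theta he
  obtain ⟨q, s, hs, hz⟩ : ∃ q s : ℤ, (s = 0 ∨ s = 1 ∨ s = -1) ∧ z = 3 * q + s :=
    ⟨(z + 1) / 3, (z + 1) % 3 - 1, by omega, by omega⟩
  have hz' : (z : ℂ) = 3 * q + s := by exact_mod_cast hz
  refine ⟨t - q * θ, sub_mem ht (mul_mem (intCast_mem _ _) theta_mem), s, intCast_mem _ _, ?_, ?_⟩
  · rcases hs with rfl | rfl | rfl <;> simp
  · linear_combination h + hz' + q * theta_sq

/-- Every Eisenstein integer is congruent to `0` or a unit modulo `2`. -/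
lemma exists_residue_two {e : ℂ} (he : e ∈ Eis) :
    ∃ t ∈ Eis, ∃ ρ ∈ Eis, (ρ = 0 ∨ ρ * conj ρ = 1) ∧ e = 2 * t + ρ := by
  obtain ⟨a, b, rfl⟩ := mem_Eis_iff.1 he
  obtain ⟨p, s, hs, ha⟩ : ∃ p s : ℤ, (s = 0 ∨ s = 1) ∧ a = 2 * p + s :=
    ⟨a / 2, a % 2, by omega, by omega⟩
  obtain ⟨q, t, ht, hb⟩ : ∃ q t : ℤ, (t = 0 ∨ t = 1) ∧ b = 2 * q + t :=
    ⟨b / 2, b % 2, by omega, by omega⟩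
  refine ⟨p + q * ω, mem_Eis_iff.2 ⟨p, q, rfl⟩, s + t * ω, mem_Eis_iff.2 ⟨s, t, rfl⟩, ?_, ?_⟩
  · rcases hs with rfl | rfl <;> rcases ht with rfl | rfl <;> simp [conj_omega] <;> right <;>
      linear_combination -omega_sq
  · rw [ha, hb]; push_cast; ring

section Hermitian

variable {n : ℕ} (x y z : Fin n → ℂ) (a : ℂ)

lemma hermF_add_left : hermF (x + y) z = hermF x z + hermF y z := by
  simp [hermF, add_mul, Finset.sum_add_distrib]

lemma hermF_smul_left : hermF (a • x) y = a * hermF x y := by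
  simp [hermF, Finset.mul_sum, mul_assoc]

lemma conj_hermF : conj (hermF x y) = hermF y x := by
  simp [hermF, mul_comm]

lemma hermF_add_right : hermF x (y + z) = hermF x y + hermF x z := by
  simp [hermF, mul_add, Finset.sum_add_distrib]

lemma hermF_smul_right : hermF x (a • y) = conj a * hermF x y := by
  rw [← conj_hermF, hermF_smul_left, map_mul, conj_hermF]

lemma hermF_sub_left : hermF (x - y) z = hermF x z - hermF y z := by
  simp [hermF, sub_mul, Finset.sum_sub_distrib]

lemma hermF_zero_left : hermF 0 x = 0 := by
  simp [hermF]

lemma hermF_sum_left {ι : Type*} (s : Finset ι) (c : ι → ℂ) (r : ι → Fin n → ℂ) :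
    hermF (∑ i ∈ s, c i • r i) x = ∑ i ∈ s, c i * hermF (r i) x := by
  classical
  induction s using Finset.induction_on with
  | empty => simp [hermF_zero_left]
  | insert i s hi ih => simp [Finset.sum_insert hi, hermF_add_left, hermF_smul_left, ih]

lemma hermF_sum_right {ι : Type*} (s : Finset ι) (c : ι → ℂ) (r : ι → Fin n → ℂ) :
    hermF x (∑ i ∈ s, c i • r i) = ∑ i ∈ s, conj (c i) * hermF x (r i) := by
  rw [← conj_hermF, hermF_sum_left, map_sum]
  simp [conj_hermF]

variable {x y} in
lemma hermF_eq_zero_comm (h : hermF x y = 0) : hermF y x = 0 := by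
  rw [← conj_hermF, h, map_zero]

lemma hermF_self : hermF x x = ((∑ i, Complex.normSq (x i) : ℝ) : ℂ) := by
  simp [hermF, Complex.mul_conj]

lemma hermF_self_re_nonneg : 0 ≤ (hermF x x).re := by
  rw [hermF_self, Complex.ofReal_re]
  exact Finset.sum_nonneg fun i _ ↦ Complex.normSq_nonneg _

lemma ofReal_hermF_self_re : (((hermF x x).re : ℝ) : ℂ) = hermF x x := by
  rw [hermF_self, Complex.ofReal_re]

variable {x} in
lemma eq_zero_of_hermF_self (h : hermF x x = 0) : x = 0 := by
  rw [hermF_self, Complex.ofReal_eq_zero,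
    Finset.sum_eq_zero_iff_of_nonneg fun i _ ↦ Complex.normSq_nonneg _] at h
  funext i
  simpa using h i (Finset.mem_univ i)

variable {x y} in
lemma hermF_self_add_of_orthogonal (h : hermF x y = 0) :
    hermF (x + y) (x + y) = hermF x x + hermF y y := by
  simp [hermF_add_left, hermF_add_right, h, hermF_eq_zero_comm h]

end Hermitian

/-- The set of Eisenstein integer combinations of a finite family of vectors. -/
def eisSpan {n k : ℕ} (r : Fin k → Fin n → ℂ) : Set (Fin n → ℂ) :=
  {x | ∃ c : Fin k → ℂ, (∀ i, c i ∈ Eis) ∧ x = ∑ i, c i • r i}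

/-- Families with equal Gram matrices span isometric Eisenstein lattices. -/
lemma latIsom_eisSpan {n m k : ℕ} (r : Fin k → Fin n → ℂ) (b : Fin k → Fin m → ℂ)
    (hG : ∀ i j, hermF (r i) (r j) = hermF (b i) (b j)) :
    LatIsom (eisSpan r) (eisSpan b) := by
  classical
  have herm (c d : Fin k → ℂ) : hermF (∑ i, c i • r i) (∑ i, d i • r i) =
      hermF (∑ i, c i • b i) (∑ i, d i • b i) := by
    simp only [hermF_sum_left, hermF_sum_right, hG]
  have sum_sub {l : ℕ} (v : Fin k → Fin l → ℂ) (c d : Fin k → ℂ) :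
      ∑ i, (c - d) i • v i = ∑ i, c i • v i - ∑ i, d i • v i := by
    simp [sub_smul, Finset.sum_sub_distrib]
  have well (c d : Fin k → ℂ) :
      ∑ i, c i • r i = ∑ i, d i • r i ↔ ∑ i, c i • b i = ∑ i, d i • b i := by
    rw [← sub_eq_zero, ← sum_sub, ← sub_eq_zero (a := ∑ i, c i • b i), ← sum_sub]
    constructor <;> intro h <;> apply eq_zero_of_hermF_self
    · rw [← herm, h, hermF_zero_left]
    · rw [herm, h, hermF_zero_left]
  let f : (Fin n → ℂ) → Fin m → ℂ := fun x ↦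
    if h : ∃ c : Fin k → ℂ, x = ∑ i, c i • r i then ∑ i, h.choose i • b i else 0
  have hf (c : Fin k → ℂ) : f (∑ i, c i • r i) = ∑ i, c i • b i := by
    have h : ∃ d : Fin k → ℂ, ∑ i, c i • r i = ∑ i, d i • r i := ⟨c, rfl⟩
    simp only [f, dif_pos h]
    exact ((well _ _).1 h.choose_spec).symm
  refine ⟨f, ⟨?_, ?_, ?_⟩, ?_, ?_, ?_⟩
  · rintro _ ⟨c, hc, rfl⟩
    exact ⟨c, hc, hf c⟩
  · rintro _ ⟨c, -, rfl⟩ _ ⟨d, -, rfl⟩ h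
    rw [hf, hf] at h
    exact (well _ _).2 h
  · rintro _ ⟨c, hc, rfl⟩
    exact ⟨_, ⟨c, hc, rfl⟩, hf c⟩
  · rintro _ ⟨c, -, rfl⟩ _ ⟨d, -, rfl⟩
    have h := hf (c + d)
    simpa [add_smul, Finset.sum_add_distrib, hf] using h
  · rintro _ ⟨c, -, rfl⟩
    have h := hf (ω • c)
    simpa [mul_smul, ← Finset.smul_sum, hf] using h
  · rintro _ ⟨c, -, rfl⟩ _ ⟨d, -, rfl⟩
    rw [hf, hf, herm]

/-- The Gram matrix of a chain of roots with consecutive products `θ`. -/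
def chainGram {k : ℕ} (i j : Fin k) : ℂ :=
  if (i : ℕ) = j then 3 else if (i : ℕ) + 1 = j then θ else if (j : ℕ) + 1 = i then -θ else 0

/-- A chain of roots of `L`. -/
structure IsChainIn {n k : ℕ} (L : Set (Fin n → ℂ)) (r : Fin k → Fin n → ℂ) : Prop where
  mem : ∀ i, r i ∈ L
  gram : ∀ i j, hermF (r i) (r j) = chainGram i j

/-- An Eisenstein lattice all of whose inner products are divisible by `θ`. -/
structure IsThetaLattice {n : ℕ} (L : Set (Fin n → ℂ)) : Prop where
  zero_mem : 0 ∈ L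
  add_mem : ∀ x ∈ L, ∀ y ∈ L, x + y ∈ L
  neg_mem : ∀ x ∈ L, -x ∈ L
  omega_smul_mem : ∀ x ∈ L, ω • x ∈ L
  theta_dvd : ∀ x ∈ L, ∀ y ∈ L, ∃ e ∈ Eis, hermF x y = θ * e

namespace IsThetaLattice

variable {n k : ℕ} {L : Set (Fin n → ℂ)}

lemma smul_mem (hL : IsThetaLattice L) {e : ℂ} (he : e ∈ Eis) {x : Fin n → ℂ} (hx : x ∈ L) :
    e • x ∈ L := by
  let A : AddSubgroup (Fin n → ℂ) :=
    { carrier := L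
      zero_mem' := hL.zero_mem
      add_mem' := fun {a b} ha hb ↦ hL.add_mem a ha b hb
      neg_mem' := fun {a} ha ↦ hL.neg_mem a ha }
  obtain ⟨a, b, rfl⟩ := mem_Eis_iff.1 he
  have h : a • x + b • (ω • x) ∈ A :=
    A.add_mem (A.zsmul_mem hx a) (A.zsmul_mem (hL.omega_smul_mem x hx) b)
  have h' : ((a : ℂ) + b * ω) • x = a • x + b • (ω • x) := by
    rw [add_smul, mul_smul, Int.cast_smul_eq_zsmul, Int.cast_smul_eq_zsmul]
  rw [h']
  exact h

lemma sum_mem (hL : IsThetaLattice L) {c : Fin k → ℂ} {r : Fin k → Fin n → ℂ}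
    (hc : ∀ i, c i ∈ Eis) (hr : ∀ i, r i ∈ L) : ∑ i, c i • r i ∈ L :=
  Finset.sum_induction _ (· ∈ L) (fun a b ha hb ↦ hL.add_mem a ha b hb) hL.zero_mem
    fun i _ ↦ hL.smul_mem (hc i) (hr i)

lemma sub_mem (hL : IsThetaLattice L) {x y : Fin n → ℂ} (hx : x ∈ L) (hy : y ∈ L) :
    x - y ∈ L := by
  rw [sub_eq_add_neg]
  exact hL.add_mem _ hx _ (hL.neg_mem _ hy)

lemma exists_norm_eq (hL : IsThetaLattice L) {x : Fin n → ℂ} (hx : x ∈ L) :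
    ∃ z : ℤ, 0 ≤ z ∧ hermF x x = 3 * z := by
  obtain ⟨e, he, h⟩ := hL.theta_dvd x hx x hx
  obtain ⟨z, hz⟩ := theta_mul_eq_of_real he ((ofReal_hermF_self_re x).trans h)
  refine ⟨z, ?_, ?_⟩
  · have h0 := hermF_self_re_nonneg x
    rw [hz] at h0
    have : (0 : ℝ) ≤ z := by linarith
    exact_mod_cast this
  · rw [← ofReal_hermF_self_re, hz]; push_cast; rfl

/-- If `m` in `L` is the projection of a root `x` to a subspace, then it is `x` or `0`. -/
lemma eq_or_eq_zero_of_orthogonal (hL : IsThetaLattice L) {x m : Fin n → ℂ} (hx : x ∈ L)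
    (hm : m ∈ L) (hx3 : hermF x x = 3) (h : hermF (x - m) m = 0) : x = m ∨ m = 0 := by
  obtain ⟨a, ha, hxa⟩ := hL.exists_norm_eq (hL.sub_mem hx hm)
  obtain ⟨b, hb, hmb⟩ := hL.exists_norm_eq hm
  have h1 := hermF_self_add_of_orthogonal h
  rw [sub_add_cancel, hx3, hxa, hmb] at h1
  have h2 : (3 : ℤ) = 3 * a + 3 * b := by exact_mod_cast h1
  rcases (by omega : a = 0 ∨ b = 0) with rfl | rfl
  · exact .inl (sub_eq_zero.1 (eq_zero_of_hermF_self (by simpa using hxa)))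
  · exact .inr (eq_zero_of_hermF_self (by simpa using hmb))

/-- Subtracting a vector `m` from a root `x` gives a root, provided that `x - m` is nonzero and
has a projection `w` of norm less than `3` onto a subspace containing `m`. -/
lemma norm_sub_eq_three (hL : IsThetaLattice L) {x m w : Fin n → ℂ} (hx : x ∈ L) (hm : m ∈ L)
    (hx3 : hermF x x = 3) (h0 : x - m ≠ 0) (hzm : hermF (x - m - w) m = 0)
    (hzw : hermF (x - m - w) w = 0) (hw : (hermF w w).re < 3) :
    hermF (x - m) (x - m) = 3 := by
  obtain ⟨a, ha, hxa⟩ := hL.exists_norm_eq (hL.sub_mem hx hm)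
  have h1 := hermF_self_add_of_orthogonal hzw
  rw [sub_add_cancel, hxa] at h1
  have h2 := hermF_self_add_of_orthogonal (x := x - m - w) (y := w + m)
    (by rw [hermF_add_right, hzw, hzm, add_zero])
  rw [show x - m - w + (w + m) = x by abel, hx3] at h2
  have h3 := congrArg Complex.re h1
  have h4 := congrArg Complex.re h2
  have h5 := hermF_self_re_nonneg (w + m)
  simp only [Complex.add_re, Complex.mul_re, Complex.re_ofNat, Complex.im_ofNat, Complex.intCast_re,
    Complex.intCast_im] at h3 h4
  have h6 : (a : ℝ) < 2 := by linarith
  have h7 : a < 2 := by exact_mod_cast h6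
  have h8 : a ≠ 0 := by
    rintro rfl
    exact h0 (eq_zero_of_hermF_self (by simpa using hxa))
  obtain rfl : a = 1 := by omega
  simpa using hxa

lemma mem_eisSpan_or_orthogonal (hL : IsThetaLattice L) {r : Fin k → Fin n → ℂ}
    (hr : IsChainIn L r) {x : Fin n → ℂ} (hx : x ∈ L) (hx3 : hermF x x = 3) {c : Fin k → ℂ}
    (hc : ∀ i, c i ∈ Eis) (h : ∀ j, hermF x (r j) - ∑ i, c i * chainGram i j = 0) :
    x ∈ eisSpan r ∨ ∀ j, hermF x (r j) = 0 := by
  have hy (j) : hermF (x - ∑ i, c i • r i) (r j) = 0 := by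
    simpa only [hermF_sub_left, hermF_sum_left, hr.gram] using h j
  rcases hL.eq_or_eq_zero_of_orthogonal hx (hL.sum_mem hc hr.mem) hx3
    (by simp [hermF_sum_right, hy]) with h1 | h1
  · exact .inl ⟨c, hc, h1⟩
  · exact .inr fun j ↦ by simpa [h1] using hy j

lemma exists_snoc_chain (hL : IsThetaLattice L) {r : Fin (k + 1) → Fin n → ℂ}
    (hr : IsChainIn L r) {w : Fin (k + 1) → ℂ}
    (hw : ∀ j, ∑ i, w i * chainGram i j = if j = Fin.last k then -θ else 0)
    (hw3 : (-θ * conj (w (Fin.last k))).re < 3)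
    {x : Fin n → ℂ} (hx : x ∈ L) (hx3 : hermF x x = 3) {c : Fin (k + 1) → ℂ}
    (hc : ∀ i, c i ∈ Eis) {ρ : ℂ} (hρ : ρ ∈ Eis) (hρ1 : ρ * conj ρ = 1)
    (h : ∀ j, hermF x (r j) - ∑ i, c i * chainGram i j = if j = Fin.last k then -θ * ρ else 0) :
    ∃ s, IsChainIn L (Fin.snoc r s : Fin (k + 2) → Fin n → ℂ) := by
  have hm := hL.sum_mem hc hr.mem
  set m := ∑ i, c i • r i with hm_def
  have hy (j) : hermF (x - m) (r j) = if j = Fin.last k then -θ * ρ else 0 := by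
    simpa only [hm_def, hermF_sub_left, hermF_sum_left, hr.gram] using h j
  have hv (j) : hermF (ρ • ∑ i, w i • r i) (r j) = if j = Fin.last k then -θ * ρ else 0 := by
    simp only [hermF_smul_left, hermF_sum_left, hr.gram, hw]
    split_ifs <;> ring
  have hz (j) : hermF (x - m - ρ • ∑ i, w i • r i) (r j) = 0 := by
    rw [hermF_sub_left, hy, hv, sub_self]
  have hz' (d : Fin (k + 1) → ℂ) :
      hermF (x - m - ρ • ∑ i, w i • r i) (∑ i, d i • r i) = 0 := by
    simp [hermF_sum_right, hz]
  have hρ0 : ρ ≠ 0 := by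
    rintro rfl
    simp at hρ1
  have h3 : hermF (x - m) (x - m) = 3 := by
    refine hL.norm_sub_eq_three (w := ρ • ∑ i, w i • r i) hx hm hx3 (fun h0 ↦ ?_) (hz' c) ?_ ?_
    · have := hy (Fin.last k)
      rw [h0, hermF_zero_left, if_pos rfl] at this
      exact mul_ne_zero (neg_ne_zero.2 theta_ne_zero) hρ0 this.symm
    · rw [hermF_smul_right, hz', mul_zero]
    · rw [hermF_smul_right, hermF_sum_right]
      simp only [hv, mul_ite, mul_zero, Finset.sum_ite_eq', Finset.mem_univ, if_true]
      rwa [show conj ρ * (conj (w (Fin.last k)) * (-θ * ρ)) = -θ * conj (w (Fin.last k)) by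
        linear_combination (-θ * conj (w (Fin.last k))) * hρ1]
  have hs (j) : hermF (conj ρ • (x - m)) (r j) = if j = Fin.last k then -θ else 0 := by
    rw [hermF_smul_left, hy]
    split_ifs
    · linear_combination -θ * hρ1
    · ring
  have hs' (j) : hermF (r j) (conj ρ • (x - m)) = if j = Fin.last k then θ else 0 := by
    rw [← conj_hermF, hs]
    split_ifs <;> simp [conj_theta]
  refine ⟨conj ρ • (x - m), fun i ↦ ?_, fun i j ↦ ?_⟩
  · induction i using Fin.lastCases with
    | last => simpa using hL.smul_mem (conj_mem_Eis hρ) (hL.sub_mem hx hm)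
    | cast i => simpa using hr.mem i
  · induction i using Fin.lastCases with
    | last =>
      induction j using Fin.lastCases with
      | last =>
        simp only [Fin.snoc_last, hermF_smul_left, hermF_smul_right, h3, chainGram, if_true,
          Complex.conj_conj]
        linear_combination 3 * hρ1
      | cast j =>
        have := j.2
        simp only [Fin.snoc_last, Fin.snoc_castSucc, hs, chainGram, Fin.ext_iff, Fin.val_last,
          Fin.val_castSucc]
        split_ifs <;> first | rfl | omega
    | cast i =>
      induction j using Fin.lastCases with
      | last =>
        have := i.2
        simp only [Fin.snoc_last, Fin.snoc_castSucc, hs', chainGram, Fin.ext_iff, Fin.val_last,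
          Fin.val_castSucc]
        split_ifs <;> first | rfl | omega
      | cast j => simpa [chainGram] using hr.gram i j

/-- If Eisenstein vectors can be reduced modulo the Gram matrix to zero or a unit in the last
coordinate, then either every root lies in the span of the chain or is orthogonal to it, or the
chain can be prolonged. -/
lemma mem_or_orthogonal_or_exists_snoc (hL : IsThetaLattice L) {r : Fin (k + 1) → Fin n → ℂ}
    (hr : IsChainIn L r) {w : Fin (k + 1) → ℂ}
    (hw : ∀ j, ∑ i, w i * chainGram i j = if j = Fin.last k then -θ else 0)
    (hw3 : (-θ * conj (w (Fin.last k))).re < 3)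
    (hred : ∀ u : Fin (k + 1) → ℂ, (∀ i, u i ∈ Eis) → ∃ c : Fin (k + 1) → ℂ, (∀ i, c i ∈ Eis) ∧
      ∃ ρ ∈ Eis, (ρ = 0 ∨ ρ * conj ρ = 1) ∧
        ∀ j, θ * u j - ∑ i, c i * chainGram i j = if j = Fin.last k then -θ * ρ else 0) :
    (∀ x ∈ L, hermF x x = 3 → x ∈ eisSpan r ∨ ∀ j, hermF x (r j) = 0) ∨
      ∃ s, IsChainIn L (Fin.snoc r s : Fin (k + 2) → Fin n → ℂ) := by
  rw [or_iff_not_imp_right]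
  intro hs x hx hx3
  choose u hu hxu using fun i ↦ hL.theta_dvd x hx (r i) (hr.mem i)
  obtain ⟨c, hc, ρ, hρ, hρ1, h⟩ := hred u hu
  simp only [← hxu] at h
  rcases hρ1 with rfl | hρ1
  · exact hL.mem_eisSpan_or_orthogonal hr hx hx3 hc fun j ↦ by simpa using h j
  · exact absurd (hL.exists_snoc_chain hr hw hw3 hx hx3 hc hρ hρ1 h) hs

end IsThetaLattice

/-- An indecomposable root lattice is spanned by a chain of its roots if every root lies in the
span or is orthogonal to it. -/
lemma eq_eisSpan_of_mem_or_orthogonal {n k : ℕ} {L : Set (Fin n → ℂ)} (hL : IsThetaLattice L)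
    (hspan : ∀ x ∈ L, ∃ (k : ℕ) (c : Fin k → ℂ) (r : Fin k → (Fin n → ℂ)),
      (∀ j, c j ∈ Eis) ∧ (∀ j, r j ∈ L ∧ hermF (r j) (r j) = 3) ∧ x = ∑ j, c j • r j)
    (hindec : ¬ ∃ S T : Set (Fin n → ℂ),
      S ∪ T = {r | r ∈ L ∧ hermF r r = 3} ∧ S ∩ T = ∅ ∧
      S.Nonempty ∧ T.Nonempty ∧ ∀ s ∈ S, ∀ t ∈ T, hermF s t = 0)
    {r : Fin (k + 1) → Fin n → ℂ} (hr : IsChainIn L r)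
    (h : ∀ x ∈ L, hermF x x = 3 → x ∈ eisSpan r ∨ ∀ j, hermF x (r j) = 0) :
    L = eisSpan r := by
  have horth {x y : Fin n → ℂ} (hx : x ∈ eisSpan r) (hy : ∀ j, hermF y (r j) = 0) :
      hermF x y = 0 := by
    obtain ⟨c, -, rfl⟩ := hx
    apply hermF_eq_zero_comm
    simp [hermF_sum_right, hy]
  have hroot : ∀ x ∈ L, hermF x x = 3 → x ∈ eisSpan r := by
    by_contra! hx
    obtain ⟨x, hx, hx3, hxr⟩ := hx
    refine hindec ⟨{x | (x ∈ L ∧ hermF x x = 3) ∧ x ∈ eisSpan r},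
      {x | (x ∈ L ∧ hermF x x = 3) ∧ ∀ j, hermF x (r j) = 0}, ?_, ?_, ?_, ?_, ?_⟩
    · ext y
      constructor
      · rintro (hy | hy) <;> exact hy.1
      · intro hy
        exact (h y hy.1 hy.2).imp (⟨hy, ·⟩) (⟨hy, ·⟩)
    · ext y
      simp only [Set.mem_inter_iff, Set.mem_ofPred_eq, Set.mem_empty_iff_false, iff_false]
      rintro ⟨⟨hy, hyr⟩, -, hyo⟩
      have := horth hyr hyo
      rw [hy.2] at this
      norm_num at this
    · refine ⟨r 0, ⟨hr.mem 0, by simp [hr.gram, chainGram]⟩, Pi.single 0 1, fun i ↦ ?_, ?_⟩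
      · rcases eq_or_ne i 0 with rfl | hi
        · simp
        · simp [hi]
      · simp [Pi.single_apply]
    · exact ⟨x, ⟨hx, hx3⟩, (h x hx hx3).resolve_left hxr⟩
    · exact fun s hs t ht ↦ horth hs.2 ht.2
  ext x
  constructor
  · intro hx
    obtain ⟨l, c, v, hc, hv, rfl⟩ := hspan x hx
    choose d hd hvd using fun j ↦ hroot (v j) (hv j).1 (hv j).2
    refine ⟨fun i ↦ ∑ j, c j * d j i, fun i ↦ sum_mem fun j _ ↦ mul_mem (hc j) (hd j i), ?_⟩
    simp only [Finset.sum_smul]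
    rw [Finset.sum_comm]
    refine Finset.sum_congr rfl fun j _ ↦ ?_
    conv_lhs => rw [hvd j]
    simp [Finset.smul_sum, mul_smul]
  · rintro ⟨c, hc, rfl⟩
    exact hL.sum_mem hc hr.mem

/-- Modulo the rows of the Gram matrix of a chain, `θ u` is zero or a unit multiple of `θ` in the
last coordinate. The choice of `c 0` determines `c`, and the last coordinate is affine in it. -/
lemma chainGram_reduction_one {u : Fin 1 → ℂ} (hu : ∀ i, u i ∈ Eis) :
    ∃ c : Fin 1 → ℂ, (∀ i, c i ∈ Eis) ∧ ∃ ρ ∈ Eis, (ρ = 0 ∨ ρ * conj ρ = 1) ∧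
      ∀ j, θ * u j - ∑ i, c i * chainGram i j = if j = Fin.last 0 then -θ * ρ else 0 := by
  obtain ⟨t, ht, ρ, hρ, hρ1, h⟩ := exists_residue_theta (neg_mem (hu 0))
  refine ⟨![t], by simpa using ht, ρ, hρ, hρ1, ?_⟩
  simp only [Fin.forall_fin_one, Fin.sum_univ_one, chainGram]
  simp
  linear_combination -θ * h - t * theta_sq

lemma chainGram_reduction_two {u : Fin 2 → ℂ} (hu : ∀ i, u i ∈ Eis) :
    ∃ c : Fin 2 → ℂ, (∀ i, c i ∈ Eis) ∧ ∃ ρ ∈ Eis, (ρ = 0 ∨ ρ * conj ρ = 1) ∧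
      ∀ j, θ * u j - ∑ i, c i * chainGram i j = if j = Fin.last 1 then -θ * ρ else 0 := by
  have hθ := theta_sq
  obtain ⟨t, ht, ρ, hρ, hρ1, h⟩ := exists_residue_two
    (sub_mem (mul_mem theta_mem (hu 0)) (hu 1))
  refine ⟨![t, -θ * t - u 0], ?_, ρ, hρ, hρ1, ?_⟩
  · simp only [Fin.forall_fin_two]
    exact ⟨ht, sub_mem (mul_mem (neg_mem theta_mem) ht) (hu 0)⟩
  · simp only [Fin.forall_fin_two, Fin.sum_univ_two, chainGram]
    constructor
    · simp
      linear_combination -t * hθ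
    · simp
      linear_combination -θ * h + u 0 * hθ

lemma chainGram_reduction_three {u : Fin 3 → ℂ} (hu : ∀ i, u i ∈ Eis) :
    ∃ c : Fin 3 → ℂ, (∀ i, c i ∈ Eis) ∧ ∃ ρ ∈ Eis, (ρ = 0 ∨ ρ * conj ρ = 1) ∧
      ∀ j, θ * u j - ∑ i, c i * chainGram i j = if j = Fin.last 2 then -θ * ρ else 0 := by
  have hθ := theta_sq
  obtain ⟨s, hs, ρ, hρ, hρ1, h⟩ := exists_residue_theta
    (sub_mem (add_mem (hu 0) (hu 0)) (hu 2))
  obtain ⟨t, ht, hts⟩ : ∃ t ∈ Eis, t = -s - u 1 := ⟨_, sub_mem (neg_mem hs) (hu 1), rfl⟩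
  have h1 := sub_mem (mul_mem (neg_mem theta_mem) ht) (hu 0)
  refine ⟨![t, -θ * t - u 0, -θ * (-θ * t - u 0) + t - u 1], ?_, ρ, hρ, hρ1, ?_⟩
  · simp only [Fin.forall_fin_succ, IsEmpty.forall_iff, and_true]
    exact ⟨ht, h1, sub_mem (add_mem (mul_mem (neg_mem theta_mem) h1) ht) (hu 1)⟩
  · simp only [Fin.forall_fin_succ, Fin.sum_univ_three, chainGram, IsEmpty.forall_iff, and_true]
    refine ⟨?_, ?_, ?_⟩
    · simp
      linear_combination -t * hθ
    · simp
      linear_combination (θ * t + u 0) * hθ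
    · simp
      rw [hts]
      linear_combination -θ * h + (s + 2 * u 1) * hθ

lemma chainGram_reduction_four {u : Fin 4 → ℂ} (hu : ∀ i, u i ∈ Eis) :
    ∃ c : Fin 4 → ℂ, (∀ i, c i ∈ Eis) ∧ ∀ j, θ * u j - ∑ i, c i * chainGram i j = 0 := by
  have hθ := theta_sq
  have hn := neg_mem theta_mem
  obtain ⟨t, ht, hts⟩ : ∃ t ∈ Eis, t = θ * u 0 - (u 1 + u 1) - θ * u 2 + u 3 :=
    ⟨_, add_mem (sub_mem (sub_mem (mul_mem theta_mem (hu 0)) (add_mem (hu 1) (hu 1)))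
      (mul_mem theta_mem (hu 2))) (hu 3), rfl⟩
  obtain ⟨c₁, h₁, hc₁⟩ : ∃ c ∈ Eis, c = -θ * t - u 0 := ⟨_, sub_mem (mul_mem hn ht) (hu 0), rfl⟩
  obtain ⟨c₂, h₂, hc₂⟩ : ∃ c ∈ Eis, c = -θ * c₁ + t - u 1 :=
    ⟨_, sub_mem (add_mem (mul_mem hn h₁) ht) (hu 1), rfl⟩
  obtain ⟨c₃, h₃, hc₃⟩ : ∃ c ∈ Eis, c = -θ * c₂ + c₁ - u 2 :=
    ⟨_, sub_mem (add_mem (mul_mem hn h₂) h₁) (hu 2), rfl⟩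
  refine ⟨![t, c₁, c₂, c₃], ?_, ?_⟩
  · simp only [Fin.forall_fin_succ, IsEmpty.forall_iff, and_true]
    exact ⟨ht, h₁, h₂, h₃⟩
  · have hc₂' : c₂ = -2 * t + θ * u 0 - u 1 := by
      rw [hc₂, hc₁]; linear_combination t * hθ
    have hc₃' : c₃ = θ * t + 2 * u 0 + θ * u 1 - u 2 := by
      rw [hc₃, hc₂', hc₁]; linear_combination -u 0 * hθ
    simp only [Fin.forall_fin_succ, Fin.sum_univ_four, chainGram, IsEmpty.forall_iff, and_true]
    refine ⟨?_, ?_, ?_, ?_⟩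
    · simp
      linear_combination θ * hc₁ - t * hθ
    · simp
      linear_combination θ * hc₂ - c₁ * hθ
    · simp
      linear_combination θ * hc₃ - c₂ * hθ
    · simp
      rw [hc₂', hc₃', hts]
      linear_combination (u 2 - 2 * u 0) * hθ

lemma dual_chainGram_one (j : Fin 1) :
    ∑ i, ![-θ / 3] i * chainGram i j = if j = Fin.last 0 then -θ else 0 := by
  simp [chainGram, Subsingleton.elim j 0]

lemma dual_chainGram_two (j : Fin 2) :
    ∑ i, ![1 / 2, -θ / 2] i * chainGram i j = if j = Fin.last 1 then -θ else 0 := by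
  have hθ := theta_sq
  fin_cases j <;> simp [Fin.sum_univ_two, chainGram]
  · linear_combination hθ / 2
  · ring

lemma dual_chainGram_three (j : Fin 3) :
    ∑ i, ![θ / 3, 1, -2 * θ / 3] i * chainGram i j = if j = Fin.last 2 then -θ else 0 := by
  have hθ := theta_sq
  fin_cases j <;> simp [Fin.sum_univ_three, chainGram]
  · linear_combination hθ
  · ring

lemma A2L_eq : A2L = eisSpan ![![θ]] := by
  ext x
  simp only [A2L, eisSpan, Set.mem_ofPred_eq, Fin.sum_univ_one]
  constructor
  · rintro ⟨e, he, h⟩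
    exact ⟨![e], by simpa using he, by funext i; fin_cases i; simp [h, mul_comm]⟩
  · rintro ⟨c, hc, rfl⟩
    exact ⟨c 0, hc 0, by simp [mul_comm]⟩

lemma D4L_eq : D4L = eisSpan ![![0, 0, θ], ![1, 1, 1]] := by
  ext x
  simp only [D4L, eisSpan, Set.mem_ofPred_eq, Fin.sum_univ_two]
  constructor
  · rintro ⟨hx, h, e, he, h'⟩
    refine ⟨![-e, x 0], by simpa [Fin.forall_fin_two] using ⟨he, hx 0⟩, ?_⟩
    funext i
    fin_cases i <;> simp
    · exact h.symm
    · linear_combination -h'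
  · rintro ⟨c, hc, rfl⟩
    refine ⟨fun i ↦ ?_, by simp, -c 0, neg_mem (hc 0), by simp [mul_comm]⟩
    fin_cases i <;> simp
    exacts [hc 1, hc 1, add_mem (mul_mem (hc 0) theta_mem) (hc 1)]

lemma E6L_eq : E6L = eisSpan ![![0, 0, θ], ![1, 1, 1], ![-θ, 0, 0]] := by
  ext x
  simp only [E6L, eisSpan, Set.mem_ofPred_eq, Fin.sum_univ_three]
  constructor
  · rintro ⟨hx, ⟨e, he, h⟩, d, hd, h'⟩
    refine ⟨![-d, x 1, -e], by simpa [Fin.forall_fin_succ] using ⟨hd, hx 1, he⟩, ?_⟩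
    funext i
    fin_cases i <;> simp
    · linear_combination h
    · linear_combination -h'
  · rintro ⟨c, hc, rfl⟩
    refine ⟨fun i ↦ ?_, ⟨-c 2, neg_mem (hc 2), by simp; ring⟩, -c 0, neg_mem (hc 0), by simp; ring⟩
    fin_cases i <;> simp
    exacts [sub_mem (hc 1) (mul_mem (hc 2) theta_mem), hc 1,
      add_mem (mul_mem (hc 0) theta_mem) (hc 1)]

lemma mem_tetracode_iff {c : Fin 4 → ZMod 3} :
    c ∈ tetracode ↔ ∃ a b : ZMod 3, c = ![b, a, a + b, a - b] := by
  simp only [tetracode, Submodule.mem_span_pair]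
  refine exists₂_congr fun a b ↦ ?_
  rw [eq_comm]
  simp [sub_eq_add_neg]

lemma val_add_sub_dvd (a b : ZMod 3) :
    ∃ q : ℤ, ((a + b).val : ℂ) - (b.val : ℂ) - (a.val : ℂ) = 3 * q := by
  have h : ∀ a b : ZMod 3, (3 : ℤ) ∣ (a + b).val - b.val - a.val := by decide
  obtain ⟨q, hq⟩ := h a b
  exact ⟨q, by exact_mod_cast hq⟩

lemma mem_E8L_iff {x : Fin 4 → ℂ} : x ∈ E8L ↔ (∀ i, x i ∈ Eis) ∧
    (∃ e ∈ Eis, x 2 - x 0 - x 1 = θ * e) ∧ ∃ e ∈ Eis, x 2 + x 0 - x 3 = θ * e := by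
  have hθ := theta_sq
  refine and_congr_right fun hx ↦ ⟨?_, ?_⟩
  · rintro ⟨c, hc, h⟩
    obtain ⟨a, b, rfl⟩ := mem_tetracode_iff.1 hc
    choose e he h using h
    obtain ⟨q, hq⟩ := val_add_sub_dvd a b
    obtain ⟨p, hp⟩ := val_add_sub_dvd (a - b) b
    rw [sub_add_cancel] at hp
    have h0 : x 0 - (b.val : ℂ) = θ * e 0 := h 0
    have h1 : x 1 - (a.val : ℂ) = θ * e 1 := h 1
    have h2 : x 2 - ((a + b).val : ℂ) = θ * e 2 := h 2
    have h3 : x 3 - ((a - b).val : ℂ) = θ * e 3 := h 3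
    refine ⟨⟨e 2 - e 0 - e 1 - θ * q, ?_, ?_⟩, e 2 + e 0 - e 3 - θ * (q + p + b.val), ?_, ?_⟩
    · exact sub_mem (sub_mem (sub_mem (he 2) (he 0)) (he 1))
        (mul_mem theta_mem (intCast_mem _ _))
    · linear_combination h2 - h0 - h1 + hq + q * hθ
    · exact sub_mem (sub_mem (add_mem (he 2) (he 0)) (he 3)) (mul_mem theta_mem
        (add_mem (add_mem (intCast_mem _ _) (intCast_mem _ _)) (natCast_mem _ _)))
    · linear_combination h2 + h0 - h3 + hq + hp + (q + p + b.val : ℂ) * hθ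
  · rintro ⟨⟨e, he, h⟩, d, hd, h'⟩
    obtain ⟨z, t, ht, hz⟩ := exists_int_residue_theta (hx 1)
    obtain ⟨y, s, hs, hy⟩ := exists_int_residue_theta (hx 0)
    refine ⟨![(y : ZMod 3), (z : ZMod 3), ((z + y : ℤ) : ZMod 3), ((z - y : ℤ) : ZMod 3)],
      mem_tetracode_iff.2 ⟨z, y, by simp⟩, ?_⟩
    obtain ⟨a₀, ha₀, h₀⟩ := int_sub_val_dvd y
    obtain ⟨a₁, ha₁, h₁⟩ := int_sub_val_dvd z
    obtain ⟨a₂, ha₂, h₂⟩ := int_sub_val_dvd (z + y)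
    obtain ⟨a₃, ha₃, h₃⟩ := int_sub_val_dvd (z - y)
    simp only [Fin.forall_fin_succ, IsEmpty.forall_iff, and_true]
    refine ⟨⟨_, add_mem hs ha₀, ?_⟩, ⟨_, add_mem ht ha₁, ?_⟩,
      ⟨_, add_mem (add_mem (add_mem he hs) ht) ha₂, ?_⟩,
      ⟨e - d + (s + s) + t - θ * y + a₃, ?_, ?_⟩⟩
    · change x 0 - ((y : ZMod 3).val : ℂ) = _
      linear_combination hy + h₀
    · change x 1 - ((z : ZMod 3).val : ℂ) = _
      linear_combination hz + h₁
    · change x 2 - (((z + y : ℤ) : ZMod 3).val : ℂ) = _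
      push_cast at h₂ ⊢
      linear_combination hy + hz + h + h₂
    · exact add_mem (sub_mem (add_mem (add_mem (sub_mem he hd) (add_mem hs hs)) ht)
        (mul_mem theta_mem (intCast_mem _ _))) ha₃
    · change x 3 - (((z - y : ℤ) : ZMod 3).val : ℂ) = _
      push_cast at h₃ ⊢
      linear_combination h - h' + 2 * hy + hz + h₃ + y * hθ

lemma E8L_eq :
    E8L = eisSpan ![![0, 0, 0, θ], ![0, 1, 1, 1], ![0, -θ, 0, 0], ![-1, -1, 1, 0]] := by
  have hθ := theta_sq
  ext x
  simp only [mem_E8L_iff, eisSpan, Set.mem_ofPred_eq, Fin.sum_univ_four]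
  constructor
  · rintro ⟨hx, ⟨e, he, h⟩, d, hd, h'⟩
    refine ⟨![-d, x 2 + x 0, e - θ * x 0, -x 0], ?_, ?_⟩
    · simp only [Fin.forall_fin_succ, IsEmpty.forall_iff, and_true]
      exact ⟨neg_mem hd, add_mem (hx 2) (hx 0), sub_mem he (mul_mem theta_mem (hx 0)),
        neg_mem (hx 0)⟩
    · funext i
      fin_cases i <;> simp
      · linear_combination -h - x 0 * hθ
      · linear_combination -h'
  · rintro ⟨c, hc, rfl⟩
    refine ⟨fun i ↦ ?_, ⟨c 2 - θ * c 3, sub_mem (hc 2) (mul_mem theta_mem (hc 3)), ?_⟩,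
      -c 0, neg_mem (hc 0), ?_⟩
    · fin_cases i <;> simp
      exacts [hc 3, by
        simpa [sub_eq_add_neg] using sub_mem (sub_mem (hc 1) (mul_mem (hc 2) theta_mem)) (hc 3),
        add_mem (hc 1) (hc 3), add_mem (mul_mem (hc 0) theta_mem) (hc 1)]
    · simp
      linear_combination c 3 * hθ
    · simp
      ring

/-- A lattice spanned by a chain is determined up to isometry by the length of the chain. -/
lemma latIsom_of_chain {n m k : ℕ} {L : Set (Fin n → ℂ)} {M : Set (Fin m → ℂ)}
    {r : Fin k → Fin n → ℂ} {b : Fin k → Fin m → ℂ} (hr : IsChainIn L r) (hL : L = eisSpan r)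
    (hM : M = eisSpan b) (hb : ∀ i j, hermF (b i) (b j) = chainGram i j) : LatIsom L M := by
  rw [hL, hM]
  exact latIsom_eisSpan r b fun i j ↦ by rw [hr.gram, hb]

/-- Every indecomposable Eisenstein root lattice is isometric to `A₂^E`, `D₄^E`,
`E₆^E` or `E₈^E`. -/
theorem stmt12 {n : ℕ} (L : Set (Fin n → ℂ))
    (h0 : (0 : Fin n → ℂ) ∈ L)
    (hadd : ∀ x ∈ L, ∀ y ∈ L, x + y ∈ L)
    (hneg : ∀ x ∈ L, -x ∈ L)
    (hω : ∀ x ∈ L, ω • x ∈ L)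
    (hdiv : ∀ x ∈ L, ∀ y ∈ L, ∃ e ∈ Eis, hermF x y = θ * e)
    (hspan : ∀ x ∈ L, ∃ (k : ℕ) (c : Fin k → ℂ) (r : Fin k → (Fin n → ℂ)),
      (∀ j, c j ∈ Eis) ∧ (∀ j, r j ∈ L ∧ hermF (r j) (r j) = 3) ∧ x = ∑ j, c j • r j)
    (hroots : ∃ r ∈ L, hermF r r = 3)
    (hindec : ¬ ∃ S T : Set (Fin n → ℂ),
      S ∪ T = {r | r ∈ L ∧ hermF r r = 3} ∧ S ∩ T = ∅ ∧
      S.Nonempty ∧ T.Nonempty ∧ ∀ s ∈ S, ∀ t ∈ T, hermF s t = 0) :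
    LatIsom L A2L ∨ LatIsom L D4L ∨ LatIsom L E6L ∨ LatIsom L E8L := by
  have hθ := theta_sq
  have hL : IsThetaLattice L := ⟨h0, hadd, hneg, hω, hdiv⟩
  obtain ⟨r₁, hr₁, hr₁3⟩ := hroots
  have c₁ : IsChainIn L (fun _ : Fin 1 ↦ r₁) :=
    ⟨fun _ ↦ hr₁, fun i j ↦ by simp [chainGram, Subsingleton.elim i j, hr₁3]⟩
  have hw₁ : (-θ * conj (-θ / 3)).re < 3 := by
    rw [show -θ * conj (-θ / 3) = (1 : ℝ) by
      simp only [map_div₀, map_neg, conj_theta, map_ofNat, Complex.ofReal_one]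
      linear_combination -hθ / 3, Complex.ofReal_re]
    norm_num
  rcases hL.mem_or_orthogonal_or_exists_snoc c₁ dual_chainGram_one hw₁
    (fun u ↦ chainGram_reduction_one) with h | ⟨r₂, c₂⟩
  · refine .inl (latIsom_of_chain c₁ (eq_eisSpan_of_mem_or_orthogonal hL hspan hindec c₁ h)
      A2L_eq ?_)
    simp [hermF, chainGram, conj_theta, hθ]
  have hw₂ : (-θ * conj (-θ / 2)).re < 3 := by
    rw [show -θ * conj (-θ / 2) = (3 / 2 : ℝ) by
      simp only [map_div₀, map_neg, conj_theta, map_ofNat]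
      push_cast
      linear_combination -hθ / 2, Complex.ofReal_re]
    norm_num
  rcases hL.mem_or_orthogonal_or_exists_snoc c₂ dual_chainGram_two hw₂
    (fun u ↦ chainGram_reduction_two) with h | ⟨r₃, c₃⟩
  · refine .inr (.inl (latIsom_of_chain c₂
      (eq_eisSpan_of_mem_or_orthogonal hL hspan hindec c₂ h) D4L_eq ?_))
    simp [Fin.forall_fin_succ, Fin.sum_univ_succ, hermF, chainGram, conj_theta, hθ]
    norm_num
  have hw₃ : (-θ * conj (-2 * θ / 3)).re < 3 := by
    rw [show -θ * conj (-2 * θ / 3) = (2 : ℝ) by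
      simp only [map_div₀, map_mul, map_neg, conj_theta, map_ofNat]
      push_cast
      linear_combination -2 * hθ / 3, Complex.ofReal_re]
    norm_num
  rcases hL.mem_or_orthogonal_or_exists_snoc c₃ dual_chainGram_three hw₃
    (fun u ↦ chainGram_reduction_three) with h | ⟨r₄, c₄⟩
  · refine .inr (.inr (.inl (latIsom_of_chain c₃
      (eq_eisSpan_of_mem_or_orthogonal hL hspan hindec c₃ h) E6L_eq ?_)))
    simp [Fin.forall_fin_succ, Fin.sum_univ_succ, hermF, chainGram, conj_theta, hθ]
    norm_num
  · refine .inr (.inr (.inr (latIsom_of_chain c₄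
      (eq_eisSpan_of_mem_or_orthogonal hL hspan hindec c₄ fun x hx hx3 ↦ ?_) E8L_eq ?_)))
    · choose u hu hxu using fun i ↦ hL.theta_dvd x hx _ (c₄.mem i)
      obtain ⟨c, hc, h⟩ := chainGram_reduction_four hu
      exact hL.mem_eisSpan_or_orthogonal c₄ hx hx3 hc fun j ↦ by rw [hxu]; exact h j
    · simp [Fin.forall_fin_succ, Fin.sum_univ_succ, hermF, chainGram, conj_theta, hθ]
      norm_num
end
end

section
/- Let M be the 12-dimensional E-lattice of all vectors in (θE)^13 with coordinate sum zero (coordinates indexed by the lines of P²𝔽₃, standard Hermitian form, with L₃(3) acting by permuting coordinates). Then the line difference code C is the unique nontrivial proper L₃(3)-invariant subspace of the coordinate-sum-zero subspace Z ⊆ 𝔽₃^13 ≅ θM'/M. -/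
noncomputable section
open scoped Classical

/-- The projective plane `P²𝔽₃`; by the duality given by the standard bilinear form,
this type also parametrizes the 13 lines. -/
abbrev P2F3 := Projectivization (ZMod 3) (Fin 3 → ZMod 3)

instance : Finite P2F3 := Quotient.finite _
noncomputable instance : Fintype P2F3 := Fintype.ofFinite P2F3

/-- Incidence of the line `ℓ` with the point `p` (a symmetric relation). -/
def incid (ℓ p : P2F3) : Prop := ∑ i, ℓ.rep i * p.rep i = 0

/-- The characteristic function of a line (dually: of a point), a vector of
`𝔽₃^13` with coordinates indexed by lines. -/
def chi (ℓ : P2F3) : P2F3 → ZMod 3 := fun p => if incid ℓ p then 1 else 0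

/-- The line difference code `C ⊆ 𝔽₃^13` (coordinates indexed by the 13 lines,
via the duality of points and lines). -/
def Cdiff : Submodule (ZMod 3) (P2F3 → ZMod 3) :=
  Submodule.span (ZMod 3) {v | ∃ ℓ m : P2F3, v = chi ℓ - chi m}

/-- Three lines are concurrent if they pass through a common point.  The
permutations of the 13 lines preserving concurrency form exactly the group
`L₃(3)` acting on the lines. -/
def Concur (a b c : P2F3) : Prop := ∃ p : P2F3, incid a p ∧ incid b p ∧ incid c p

/-- The coordinate-sum-zero hyperplane `Z ⊆ 𝔽₃^13`. -/
def Zsum : Submodule (ZMod 3) (P2F3 → ZMod 3) where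
  carrier := {x | ∑ ℓ : P2F3, x ℓ = 0}
  zero_mem' := by simp
  add_mem' := by
    intro a b ha hb
    simp only [Set.mem_setOf_eq, Pi.add_apply, Finset.sum_add_distrib] at *
    rw [ha, hb, add_zero]
  smul_mem' := by
    intro c x hx
    simp only [Set.mem_setOf_eq, Pi.smul_apply, smul_eq_mul, ← Finset.mul_sum] at *
    rw [hx, mul_zero]

/-- Incidence in the Singer model of the projective plane of order three: points and lines are
labelled by the residues modulo `13`. -/
def SingerInc (i j : Fin 13) : Prop := i + j ∈ ({1, 3, 10, 11} : Finset (Fin 13))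

instance (i j : Fin 13) : Decidable (SingerInc i j) :=
  inferInstanceAs (Decidable (i + j ∈ ({1, 3, 10, 11} : Finset (Fin 13))))

/-- Concurrency of three lines in the Singer model. -/
def SingerConcur (a b c : Fin 13) : Prop := ∃ p, SingerInc a p ∧ SingerInc b p ∧ SingerInc c p

/-- A permutation of the lines of the Singer model that preserves concurrency. -/
def PreservesConcur (σ : Equiv.Perm (Fin 13)) : Prop :=
  ∀ a b c, SingerConcur (σ a) (σ b) (σ c) ↔ SingerConcur a b c

/-- The characteristic function of a line in the Singer model. -/
def singerChi (j : Fin 13) : Fin 13 → ZMod 3 := fun i => if SingerInc j i then 1 else 0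

/-- The line difference code of the Singer model. -/
def singerCode : Submodule (ZMod 3) (Fin 13 → ZMod 3) :=
  Submodule.span (ZMod 3) {v | ∃ i j, v = singerChi i - singerChi j}

lemma singerInc_comm (i j : Fin 13) : SingerInc i j ↔ SingerInc j i := by
  rw [SingerInc, SingerInc, add_comm]

lemma SingerInc.unique {a b p q : Fin 13} (hab : a ≠ b) (hap : SingerInc a p)
    (hbp : SingerInc b p) (haq : SingerInc a q) (hbq : SingerInc b q) : p = q := by
  revert a b p q
  decide

lemma exists_pair_singerInc (p : Fin 13) : ∃ a b, a ≠ b ∧ SingerInc a p ∧ SingerInc b p := by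
  revert p
  decide

lemma sum_singerChi (j : Fin 13) : ∑ i, singerChi j i = 1 := by
  revert j
  decide

lemma PreservesConcur.symm {σ : Equiv.Perm (Fin 13)} (hσ : PreservesConcur σ) :
    PreservesConcur σ.symm := fun a b c => by
  rw [← hσ, Equiv.apply_symm_apply, Equiv.apply_symm_apply, Equiv.apply_symm_apply]

lemma preservesConcur_of_singerInc {σ τ : Equiv.Perm (Fin 13)}
    (h : ∀ i j, SingerInc (σ i) (τ j) ↔ SingerInc i j) : PreservesConcur σ := fun a b c => by
  constructor
  · rintro ⟨p, hp⟩
    refine ⟨τ.symm p, ?_⟩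
    simpa only [← h _ (τ.symm p), Equiv.apply_symm_apply] using hp
  · rintro ⟨p, hp⟩
    refine ⟨τ p, ?_⟩
    simpa only [h] using hp

/-- A concurrency-preserving permutation maps pencils to pencils. -/
lemma PreservesConcur.exists_singerInc_iff {σ : Equiv.Perm (Fin 13)} (hσ : PreservesConcur σ)
    (p : Fin 13) : ∃ q, ∀ c, SingerInc (σ c) p ↔ SingerInc c q := by
  obtain ⟨a, b, hab, ha, hb⟩ := exists_pair_singerInc p
  obtain ⟨a, rfl⟩ := σ.surjective a
  obtain ⟨b, rfl⟩ := σ.surjective b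
  obtain ⟨q, haq, hbq, -⟩ := (hσ a b b).1 ⟨p, ha, hb, hb⟩
  have hab' : a ≠ b := fun h => hab (h ▸ rfl)
  refine ⟨q, fun c => ⟨fun hc => ?_, fun hc => ?_⟩⟩
  · obtain ⟨r, har, hbr, hcr⟩ := (hσ a b c).1 ⟨p, ha, hb, hc⟩
    rwa [SingerInc.unique hab' haq hbq har hbr]
  · obtain ⟨r, har, hbr, hcr⟩ := (hσ a b c).2 ⟨q, haq, hbq, hc⟩
    rwa [SingerInc.unique hab ha hb har hbr]

lemma PreservesConcur.exists_singerChi_comp {σ : Equiv.Perm (Fin 13)} (hσ : PreservesConcur σ)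
    (p : Fin 13) : ∃ q, singerChi p ∘ σ = singerChi q := by
  obtain ⟨q, hq⟩ := hσ.exists_singerInc_iff p
  refine ⟨q, funext fun c => ?_⟩
  simp only [Function.comp_apply, singerChi, singerInc_comm p, singerInc_comm q, hq]

lemma singerCode_comp_mem {σ : Equiv.Perm (Fin 13)} (hσ : PreservesConcur σ)
    {x : Fin 13 → ZMod 3} (hx : x ∈ singerCode) : x ∘ σ ∈ singerCode := by
  have h : singerCode ≤ singerCode.comap (LinearMap.funLeft (ZMod 3) (ZMod 3) σ) := by
    refine Submodule.span_le.2 ?_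
    rintro _ ⟨i, j, rfl⟩
    obtain ⟨i', hi⟩ := hσ.exists_singerChi_comp i
    obtain ⟨j', hj⟩ := hσ.exists_singerChi_comp j
    refine Submodule.subset_span ⟨i', j', ?_⟩
    rw [← hi, ← hj]
    rfl
  exact h hx

/-- The Singer cycle and its powers. -/
def singerShift (k : Fin 13) : Equiv.Perm (Fin 13) := Equiv.addRight k

lemma preservesConcur_singerShift (k : Fin 13) : PreservesConcur (singerShift k) :=
  preservesConcur_of_singerInc (τ := singerShift (-k)) fun i j => by
    have h : i + k + (j + -k) = i + j := by abel
    simp only [singerShift, Equiv.coe_addRight, SingerInc, h]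

lemma singerChi_comp_singerShift (j k : Fin 13) :
    singerChi j ∘ singerShift k = singerChi (j + k) := by
  funext i
  have h : j + (i + k) = j + k + i := by abel
  refine if_congr ?_ rfl rfl
  simp only [singerShift, Equiv.coe_addRight, SingerInc, h]

/-- An elation with axis `0` and center `1`. -/
def elationOne : Equiv.Perm (Fin 13) where
  toFun := ![6, 1, 7, 3, 0, 2, 4, 5, 9, 12, 10, 11, 8]
  invFun := ![4, 1, 5, 3, 6, 7, 0, 2, 12, 8, 10, 11, 9]
  left_inv := by decide
  right_inv := by decide

/-- An elation with axis `0` and center `3`. -/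
def elationThree : Equiv.Perm (Fin 13) where
  toFun := ![5, 1, 8, 3, 7, 12, 2, 9, 6, 4, 10, 11, 0]
  invFun := ![12, 1, 6, 3, 9, 0, 8, 4, 2, 7, 10, 11, 5]
  left_inv := by decide
  right_inv := by decide

lemma preservesConcur_elationOne : PreservesConcur elationOne :=
  preservesConcur_of_singerInc
    (τ := ⟨![0, 4, 2, 5, 6, 12, 1, 11, 7, 9, 10, 8, 3], ![0, 6, 2, 12, 1, 3, 4, 8, 11, 9, 10, 7, 5],
      by decide, by decide⟩) (by decide)

lemma preservesConcur_elationThree : PreservesConcur elationThree :=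
  preservesConcur_of_singerInc
    (τ := ⟨![0, 6, 10, 5, 1, 12, 4, 7, 8, 2, 9, 11, 3], ![0, 4, 9, 12, 6, 3, 1, 7, 8, 10, 2, 11, 5],
      by decide, by decide⟩) (by decide)

/-- The sum of the translates of `x` under the group generated by `elationOne`. -/
lemma sum_comp_elationOne (x : Fin 13 → ZMod 3) (hx : ∀ j, ∑ i, singerChi j i * x i = 0) :
    x + x ∘ elationOne + x ∘ elationOne ∘ elationOne = (-x 1) • (1 - singerChi 0) := by
  have h0 := hx 0
  have h2 := hx 2
  have h9 := hx 9
  have h10 := hx 10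
  simp [singerChi, SingerInc, Fin.sum_univ_succ] at h0 h2 h9 h10
  funext i
  fin_cases i <;> simp [elationOne, singerChi, SingerInc] <;> grind

/-- The sum of the translates of `x` under the group generated by `elationOne` and
`elationThree`. -/
lemma sum_comp_elationThree (x y : Fin 13 → ZMod 3) (hx : ∑ i, x i = 0)
    (hy : y = x + x ∘ elationOne + x ∘ elationOne ∘ elationOne) :
    y + y ∘ elationThree + y ∘ elationThree ∘ elationThree =
      (-∑ i, singerChi 0 i * x i) • (1 - singerChi 0) := by
  subst hy
  simp [Fin.sum_univ_succ] at hx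
  funext i
  fin_cases i <;>
    simp [elationOne, elationThree, singerChi, SingerInc, Fin.sum_univ_succ] <;> grind

lemma singerCode_le_of_one_sub_mem {U : Submodule (ZMod 3) (Fin 13 → ZMod 3)}
    (hU : ∀ σ, PreservesConcur σ → ∀ x ∈ U, x ∘ σ ∈ U) (h : 1 - singerChi 0 ∈ U) :
    singerCode ≤ U := by
  have key (j : Fin 13) : 1 - singerChi j ∈ U := by
    have h' : (1 - singerChi 0) ∘ singerShift j = 1 - singerChi j := by
      rw [← zero_add j, ← singerChi_comp_singerShift, zero_add]
      rfl
    exact h' ▸ hU _ (preservesConcur_singerShift j) _ h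
  refine Submodule.span_le.2 ?_
  rintro _ ⟨i, j, rfl⟩
  simpa using U.sub_mem (key j) (key i)

/-- Every nonzero invariant subspace of the coordinate-sum-zero hyperplane contains the line
difference code. -/
lemma singerCode_le {U : Submodule (ZMod 3) (Fin 13 → ZMod 3)}
    (hU : ∀ σ, PreservesConcur σ → ∀ x ∈ U, x ∘ σ ∈ U) (hU0 : U ≠ ⊥)
    (hsum : ∀ x ∈ U, ∑ i, x i = 0) : singerCode ≤ U := by
  have horbit {σ : Equiv.Perm (Fin 13)} (hσ : PreservesConcur σ) {x : Fin 13 → ZMod 3}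
      (hx : x ∈ U) : x + x ∘ σ + x ∘ σ ∘ σ ∈ U :=
    U.add_mem (U.add_mem hx (hU _ hσ _ hx)) (hU _ hσ _ (hU _ hσ _ hx))
  by_cases hline : ∀ x ∈ U, ∀ j, ∑ i, singerChi j i * x i = 0
  · obtain ⟨x, hx, hx0⟩ := Submodule.exists_mem_ne_zero_of_ne_bot hU0
    obtain ⟨k, hk⟩ := Function.ne_iff.1 hx0
    have hy := hU _ (preservesConcur_singerShift (k - 1)) x hx
    have hy1 : (x ∘ singerShift (k - 1)) 1 ≠ 0 := by
      simpa [singerShift] using hk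
    have hmem := horbit preservesConcur_elationOne hy
    rw [sum_comp_elationOne _ (hline _ hy), U.smul_mem_iff (neg_ne_zero.2 hy1)] at hmem
    exact singerCode_le_of_one_sub_mem hU hmem
  · push Not at hline
    obtain ⟨x, hx, j, hj⟩ := hline
    have hy := hU _ (preservesConcur_singerShift (-j)) x hx
    have hy0 : ∑ i, singerChi 0 i * (x ∘ singerShift (-j)) i ≠ 0 := by
      rw [← Equiv.sum_comp (singerShift (-j))] at hj
      rw [← add_neg_cancel j, ← singerChi_comp_singerShift]
      exact hj
    have hmem := horbit preservesConcur_elationThree (horbit preservesConcur_elationOne hy)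
    rw [sum_comp_elationThree _ _ (hsum _ hy) rfl, U.smul_mem_iff (neg_ne_zero.2 hy0)] at hmem
    exact singerCode_le_of_one_sub_mem hU hmem

/-- A vector orthogonal to all lines lies in the line difference code. -/
lemma mem_singerCode {x : Fin 13 → ZMod 3} (hx : ∀ j, ∑ i, singerChi j i * x i = 0) :
    x ∈ singerCode := by
  have hmem (a : ZMod 3) (k : Fin 13) : a • (singerChi k - singerChi 0) ∈ singerCode :=
    singerCode.smul_mem _ (Submodule.subset_span ⟨k, 0, rfl⟩)
  have h : x = x 2 • (singerChi 1 - singerChi 0)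
      + (x 1 + 2 * x 3) • (singerChi 2 - singerChi 0)
      + (x 0 + 2 * x 2) • (singerChi 3 - singerChi 0)
      + (2 * x 0 + 2 * x 1 + 2 * x 5) • (singerChi 4 - singerChi 0)
      + (2 * x 4 + x 5) • (singerChi 5 - singerChi 0)
      + x 4 • (singerChi 6 - singerChi 0) := by
    clear hmem
    simp [Fin.forall_fin_succ, singerChi, SingerInc, Fin.sum_univ_succ] at hx
    funext i
    fin_cases i <;> simp [singerChi, SingerInc] <;> grind
  rw [h]
  exact add_mem (add_mem (add_mem (add_mem (add_mem (hmem _ _) (hmem _ _)) (hmem _ _))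
    (hmem _ _)) (hmem _ _)) (hmem _ _)

/-- If the sums of `x` over any two lines agree, then they vanish, provided that the
coordinate sum of `x` does. -/
lemma sum_singerChi_mul_eq_zero {x : Fin 13 → ZMod 3} (hx : ∑ i, x i = 0)
    (h : ∀ j k, ∑ i, singerChi j i * x i = ∑ i, singerChi k i * x i) (j : Fin 13) :
    ∑ i, singerChi j i * x i = 0 := by
  rw [h j 0]
  have h2 := h 0 2
  have h9 := h 0 9
  have h10 := h 0 10
  simp [singerChi, SingerInc, Fin.sum_univ_succ] at hx h2 h9 h10 ⊢
  grind

/-- The line difference code is the only nonzero proper invariant subspace of the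
coordinate-sum-zero hyperplane. -/
theorem eq_singerCode {W : Submodule (ZMod 3) (Fin 13 → ZMod 3)}
    (hW : ∀ σ, PreservesConcur σ → ∀ x ∈ W, x ∘ σ ∈ W) (hW0 : W ≠ ⊥)
    (hsum : ∀ x ∈ W, ∑ i, x i = 0) (hproper : ∃ z, ∑ i, z i = 0 ∧ z ∉ W) :
    W = singerCode := by
  refine le_antisymm (fun x hx => ?_) (singerCode_le hW hW0 hsum)
  obtain ⟨z, hz, hzW⟩ := hproper
  obtain ⟨f, hfz, hfW⟩ := Submodule.exists_le_ker_of_notMem hzW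
  let V : Submodule (ZMod 3) (Fin 13 → ZMod 3) :=
    { carrier := {y | ∑ i, y i = 0 ∧ ∀ w ∈ W, ∑ i, y i * w i = 0}
      zero_mem' := by simp
      add_mem' := fun {a b} ha hb => by
        refine ⟨by simp [Finset.sum_add_distrib, ha.1, hb.1], fun w hw => ?_⟩
        simp [add_mul, Finset.sum_add_distrib, ha.2 w hw, hb.2 w hw]
      smul_mem' := fun c a ha => by
        refine ⟨by simp [← Finset.mul_sum, ha.1], fun w hw => ?_⟩
        simp [mul_assoc, ← Finset.mul_sum, ha.2 w hw] }
  have hV : ∀ σ, PreservesConcur σ → ∀ y ∈ V, y ∘ σ ∈ V := by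
    refine fun σ hσ y hy => ⟨(Equiv.sum_comp σ y).trans hy.1, fun w hw => ?_⟩
    rw [← hy.2 _ (hW _ hσ.symm _ hw), ← Equiv.sum_comp σ fun i => y i * (w ∘ σ.symm) i]
    simp
  have hf (w : Fin 13 → ZMod 3) : f w = ∑ i, f (Pi.single i 1) * w i := by
    conv_lhs => rw [pi_eq_sum_univ' w]
    simp [mul_comm]
  have hV0 : V ≠ ⊥ := by
    let s := ∑ i, f (Pi.single i 1)
    have hdot (w : Fin 13 → ZMod 3) (hw : ∑ i, w i = 0) :
        ∑ i, (f (Pi.single i 1) - s) * w i = f w := by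
      rw [hf]
      simp [sub_mul, Finset.sum_sub_distrib, ← Finset.mul_sum, hw]
    have hmem : (fun i => f (Pi.single i 1) - s) ∈ V := by
      refine ⟨?_, fun w hw => (hdot w (hsum w hw)).trans (hfW hw)⟩
      have h13 : (13 : ZMod 3) = 1 := rfl
      simp [Finset.sum_sub_distrib, h13, s]
    intro hbot
    rw [hbot, Submodule.mem_bot] at hmem
    apply hfz
    rw [← hdot z hz]
    exact Finset.sum_eq_zero fun i _ => by rw [congrFun hmem i, Pi.zero_apply, zero_mul]
  have hle := singerCode_le hV hV0 fun y hy => hy.1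
  refine mem_singerCode (sum_singerChi_mul_eq_zero (hsum x hx) fun j k => ?_)
  have h := (hle (Submodule.subset_span ⟨j, k, rfl⟩)).2 x hx
  simpa [sub_mul, Finset.sum_sub_distrib, sub_eq_zero] using h

/-- Homogeneous coordinates of the points of the Singer model. -/
def singerVec : Fin 13 → Fin 3 → ZMod 3 :=
  ![![1, 0, 0], ![0, 0, 1], ![1, 1, 0], ![0, 1, 2], ![1, 0, 2], ![1, 1, 2], ![1, 0, 1],
    ![1, 1, 1], ![1, 2, 2], ![1, 2, 0], ![0, 1, 0], ![0, 1, 1], ![1, 2, 1]]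

lemma singerVec_ne_zero (i : Fin 13) : singerVec i ≠ 0 := by
  revert i
  decide

/-- The labelling of the projective plane over `𝔽₃` by residues modulo `13`. -/
def singerEquiv : Fin 13 ≃ P2F3 :=
  Equiv.ofBijective (fun i => Projectivization.mk (ZMod 3) (singerVec i) (singerVec_ne_zero i)) <| by
    constructor
    · intro i j hij
      rw [Projectivization.mk_eq_mk_iff'] at hij
      revert i j
      decide
    · intro p
      induction p using Projectivization.ind with | h v hv =>
      have key : ∀ a b c : ZMod 3, ![a, b, c] ≠ 0 → ∃ i, ∃ t : ZMod 3,
          t • ![a, b, c] = singerVec i := by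
        decide
      have hv' : v = ![v 0, v 1, v 2] := by
        funext i
        fin_cases i <;> rfl
      obtain ⟨i, hi⟩ := key (v 0) (v 1) (v 2) (hv' ▸ hv)
      refine ⟨i, (Projectivization.mk_eq_mk_iff' _ _ _ _ _).2 ?_⟩
      rwa [← hv'] at hi

lemma incid_mk {u v : Fin 3 → ZMod 3} (hu : u ≠ 0) (hv : v ≠ 0) :
    incid (Projectivization.mk (ZMod 3) u hu) (Projectivization.mk (ZMod 3) v hv) ↔
      ∑ i, u i * v i = 0 := by
  obtain ⟨a, ha⟩ := Projectivization.exists_smul_eq_mk_rep (ZMod 3) u hu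
  obtain ⟨b, hb⟩ := Projectivization.exists_smul_eq_mk_rep (ZMod 3) v hv
  have h : ∑ i, (a • u) i * (b • v) i = (a * b : ZMod 3) * ∑ i, u i * v i := by
    rw [Finset.mul_sum]
    refine Finset.sum_congr rfl fun i _ => ?_
    simp only [Pi.smul_apply, Units.smul_def, smul_eq_mul]
    ring
  rw [incid, ← ha, ← hb, h, mul_eq_zero, or_iff_right (mul_ne_zero a.ne_zero b.ne_zero)]

lemma incid_singerEquiv (i j : Fin 13) :
    incid (singerEquiv i) (singerEquiv j) ↔ SingerInc i j := by
  refine (incid_mk (singerVec_ne_zero i) (singerVec_ne_zero j)).trans ?_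
  revert i j
  decide

lemma concur_singerEquiv (a b c : Fin 13) :
    Concur (singerEquiv a) (singerEquiv b) (singerEquiv c) ↔ SingerConcur a b c := by
  rw [Concur, ← singerEquiv.exists_congr_right]
  simp only [incid_singerEquiv, SingerConcur]

lemma preservesConcur_iff (σ : Equiv.Perm P2F3) :
    PreservesConcur (singerEquiv.trans (σ.trans singerEquiv.symm)) ↔
      ∀ a b c, Concur (σ a) (σ b) (σ c) ↔ Concur a b c := by
  simp only [PreservesConcur, ← concur_singerEquiv, ← singerEquiv.forall_congr_right,
    Equiv.trans_apply, Equiv.apply_symm_apply]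

/-- The coordinates of a vector indexed by the projective plane. -/
def coordMap : (P2F3 → ZMod 3) ≃ₗ[ZMod 3] (Fin 13 → ZMod 3) :=
  LinearEquiv.funCongrLeft (ZMod 3) (ZMod 3) singerEquiv

lemma coordMap_apply (x : P2F3 → ZMod 3) (i : Fin 13) : coordMap x i = x (singerEquiv i) := rfl

lemma coordMap_chi (j : Fin 13) : coordMap (chi (singerEquiv j)) = singerChi j := by
  funext i
  exact if_congr (incid_singerEquiv j i) rfl rfl

lemma map_Cdiff : Cdiff.map coordMap.toLinearMap = singerCode := by
  rw [Cdiff, Submodule.map_span, singerCode]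
  congr 1
  ext v
  constructor
  · rintro ⟨_, ⟨l, m, rfl⟩, rfl⟩
    obtain ⟨i, rfl⟩ := singerEquiv.surjective l
    obtain ⟨j, rfl⟩ := singerEquiv.surjective m
    exact ⟨i, j, by simp [coordMap_chi]⟩
  · rintro ⟨i, j, rfl⟩
    exact ⟨_, ⟨singerEquiv i, singerEquiv j, rfl⟩, by simp [coordMap_chi]⟩

lemma mem_Cdiff_iff (x : P2F3 → ZMod 3) : x ∈ Cdiff ↔ coordMap x ∈ singerCode := by
  rw [← map_Cdiff, Submodule.mem_map_equiv, LinearEquiv.symm_apply_apply]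

lemma mem_Zsum_iff (x : P2F3 → ZMod 3) : x ∈ Zsum ↔ ∑ i, coordMap x i = 0 := by
  rw [show ∑ i, coordMap x i = ∑ l, x l from Equiv.sum_comp singerEquiv x]
  rfl

lemma sum_eq_zero_of_mem_singerCode {x : Fin 13 → ZMod 3} (hx : x ∈ singerCode) :
    ∑ i, x i = 0 := by
  induction hx using Submodule.span_induction with
  | mem x hx =>
    obtain ⟨i, j, rfl⟩ := hx
    simp [Finset.sum_sub_distrib, sum_singerChi]
  | zero => simp
  | add x y _ _ hx hy => simp [Finset.sum_add_distrib, hx, hy]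
  | smul a x _ hx => simp [← Finset.mul_sum, hx]

lemma sum_singerChi_mul_of_mem_singerCode {x : Fin 13 → ZMod 3} (hx : x ∈ singerCode)
    (k : Fin 13) : ∑ i, singerChi k i * x i = 0 := by
  induction hx using Submodule.span_induction with
  | mem x hx =>
    obtain ⟨i, j, rfl⟩ := hx
    have h : ∀ k j, ∑ i, singerChi k i * singerChi j i = 1 := by decide
    simp [mul_sub, Finset.sum_sub_distrib, h]
  | zero => simp
  | add x y _ _ hx hy => simp [mul_add, Finset.sum_add_distrib, hx, hy]
  | smul a x _ hx => simp [mul_left_comm, ← Finset.mul_sum, hx]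

/-- The line difference code `C` is the unique nontrivial proper subspace of `Z`
invariant under `L₃(3)` (realized as the group of concurrency-preserving
permutations of the 13 lines, permuting coordinates). -/
theorem stmt18 :
    (Cdiff ≤ Zsum ∧ Cdiff ≠ ⊥ ∧ Cdiff ≠ Zsum ∧
      (∀ σ : Equiv.Perm P2F3, (∀ a b c, Concur (σ a) (σ b) (σ c) ↔ Concur a b c) →
        ∀ x ∈ Cdiff, (x ∘ σ) ∈ Cdiff)) ∧
    ∀ W : Submodule (ZMod 3) (P2F3 → ZMod 3),
      W ≤ Zsum → W ≠ ⊥ → W ≠ Zsum →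
      (∀ σ : Equiv.Perm P2F3, (∀ a b c, Concur (σ a) (σ b) (σ c) ↔ Concur a b c) →
        ∀ x ∈ W, (x ∘ σ) ∈ W) →
      W = Cdiff := by
  refine ⟨⟨fun x hx => ?_, fun h => ?_, fun h => ?_, fun σ hσ x hx => ?_⟩,
    fun W hWZ hW0 hW hinv => ?_⟩
  · rw [mem_Zsum_iff]
    exact sum_eq_zero_of_mem_singerCode ((mem_Cdiff_iff x).1 hx)
  · have hmem : singerChi 0 - singerChi 1 ∈ singerCode := Submodule.subset_span ⟨0, 1, rfl⟩
    rw [← map_Cdiff, h, Submodule.map_bot, Submodule.mem_bot] at hmem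
    revert hmem
    decide
  · have hZ : coordMap.symm (Pi.single 0 1 - Pi.single 1 1) ∈ Zsum := by
      rw [mem_Zsum_iff, LinearEquiv.apply_symm_apply]
      decide
    rw [← h, mem_Cdiff_iff, LinearEquiv.apply_symm_apply] at hZ
    have h0 := sum_singerChi_mul_of_mem_singerCode hZ 0
    revert h0
    decide
  · rw [mem_Cdiff_iff] at hx ⊢
    convert singerCode_comp_mem ((preservesConcur_iff σ).2 hσ) hx using 1
    funext i
    simp [coordMap_apply]
  · have hmem (x : Fin 13 → ZMod 3) : x ∈ W.map coordMap.toLinearMap ↔ coordMap.symm x ∈ W :=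
      Submodule.mem_map_equiv W
    apply Submodule.map_injective_of_injective (f := coordMap.toLinearMap) coordMap.injective
    rw [map_Cdiff]
    refine eq_singerCode (fun σ hσ x hx => ?_) ?_ (fun x hx => ?_) ?_
    · rw [hmem] at hx ⊢
      have hcomp : coordMap.symm (x ∘ σ) =
          coordMap.symm x ∘ singerEquiv.symm.trans (σ.trans singerEquiv) := by
        rw [LinearEquiv.symm_apply_eq]
        funext i
        rw [coordMap_apply, Function.comp_apply, Function.comp_apply, Equiv.trans_apply,
          Equiv.trans_apply, Equiv.symm_apply_apply, ← coordMap_apply (coordMap.symm x),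
          LinearEquiv.apply_symm_apply]
      rw [hcomp]
      refine hinv _ ?_ _ hx
      rw [← preservesConcur_iff]
      convert hσ
      ext i
      simp
    · rwa [Ne, Submodule.map_eq_bot_iff]
    · rw [hmem] at hx
      simpa using (mem_Zsum_iff _).1 (hWZ hx)
    · obtain ⟨z, hz, hzW⟩ := SetLike.exists_of_lt (lt_of_le_of_ne hWZ hW)
      refine ⟨coordMap z, (mem_Zsum_iff z).1 hz, ?_⟩
      rwa [hmem, LinearEquiv.symm_apply_apply]
end
end

section
/- The ternary Golay code is, up to monomial equivalence, the unique self-dual code of length 12 over 𝔽₃ with no codewords of Hamming weight 3. -/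
/-- The Hamming weight of a word of `𝔽₃^12`. -/
def wt (x : Fin 12 → ZMod 3) : ℕ := (Finset.univ.filter (fun i => x i ≠ 0)).card

/-- A code `C ⊆ 𝔽₃^12` is self-dual if it equals its dual with respect to the
standard bilinear form. -/
def IsSelfDual (C : Submodule (ZMod 3) (Fin 12 → ZMod 3)) : Prop :=
  (C : Set (Fin 12 → ZMod 3)) = {y | ∀ x ∈ C, ∑ i, x i * y i = 0}

/-- Monomial equivalence of codes: a permutation of the coordinates composed with
sign changes of individual coordinates takes one code onto the other. -/
def MonomialEquiv (C D : Submodule (ZMod 3) (Fin 12 → ZMod 3)) : Prop :=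
  ∃ (σ : Equiv.Perm (Fin 12)) (ε : Fin 12 → ZMod 3),
    (∀ i, ε i = 1 ∨ ε i = -1) ∧
    ∀ y : Fin 12 → ZMod 3, y ∈ D ↔ (fun i => ε i * y (σ i)) ∈ C

open Matrix

namespace TernaryGolay

/-- The code with generator matrix `[I | A]`, where `τ` places the information and the check
coordinates. -/
def systematicCode (τ : Fin 6 ⊕ Fin 6 ≃ Fin 12) (A : Matrix (Fin 6) (Fin 6) (ZMod 3)) :
    Submodule (ZMod 3) (Fin 12 → ZMod 3) where
  carrier := {y | ∀ j, y (τ (.inr j)) = ∑ i, y (τ (.inl i)) * A i j}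
  add_mem' := by
    intro x y hx hy j
    simp only [Pi.add_apply, hx j, hy j, add_mul, Finset.sum_add_distrib]
  zero_mem' := by intro j; simp
  smul_mem' := by
    intro a x hx j
    simp only [Pi.smul_apply, smul_eq_mul, hx j, Finset.mul_sum, mul_assoc]

theorem mem_systematicCode {τ : Fin 6 ⊕ Fin 6 ≃ Fin 12} {A : Matrix (Fin 6) (Fin 6) (ZMod 3)}
    {y : Fin 12 → ZMod 3} :
    y ∈ systematicCode τ A ↔ ∀ j, y (τ (.inr j)) = ∑ i, y (τ (.inl i)) * A i j :=
  Iff.rfl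

/-- The codeword with information part `u`. -/
def encode (τ : Fin 6 ⊕ Fin 6 ≃ Fin 12) (A : Matrix (Fin 6) (Fin 6) (ZMod 3))
    (u : Fin 6 → ZMod 3) : Fin 12 → ZMod 3 :=
  Sum.elim u (u ᵥ* A) ∘ τ.symm

theorem encode_mem (τ : Fin 6 ⊕ Fin 6 ≃ Fin 12) (A : Matrix (Fin 6) (Fin 6) (ZMod 3))
    (u : Fin 6 → ZMod 3) : encode τ A u ∈ systematicCode τ A := by
  intro j
  simp [encode, vecMul, dotProduct]

theorem eq_encode {τ : Fin 6 ⊕ Fin 6 ≃ Fin 12} {A : Matrix (Fin 6) (Fin 6) (ZMod 3)}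
    {y : Fin 12 → ZMod 3} (hy : y ∈ systematicCode τ A) :
    y = encode τ A (fun i => y (τ (.inl i))) := by
  ext k
  obtain ⟨s, rfl⟩ := τ.surjective k
  rcases s with i | j
  · simp [encode]
  · simp [encode, vecMul, dotProduct, hy j]

theorem sum_mul_encode (τ : Fin 6 ⊕ Fin 6 ≃ Fin 12) (A : Matrix (Fin 6) (Fin 6) (ZMod 3))
    (u : Fin 6 → ZMod 3) (y : Fin 12 → ZMod 3) :
    ∑ k, encode τ A u k * y k =
      u ⬝ᵥ (fun i => y (τ (.inl i))) + (u ᵥ* A) ⬝ᵥ (fun j => y (τ (.inr j))) := by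
  rw [← τ.sum_comp]
  simp [encode, dotProduct]

theorem sum_encode_mul_encode (τ : Fin 6 ⊕ Fin 6 ≃ Fin 12)
    (A : Matrix (Fin 6) (Fin 6) (ZMod 3)) (u v : Fin 6 → ZMod 3) :
    ∑ k, encode τ A u k * encode τ A v k = u ⬝ᵥ v + u ⬝ᵥ ((A * Aᵀ) *ᵥ v) := by
  rw [sum_mul_encode]
  simp only [encode, Function.comp_apply, Equiv.symm_apply_apply, Sum.elim_inl, Sum.elim_inr]
  rw [← mulVec_mulVec, dotProduct_mulVec, mulVec_transpose]

theorem wt_encode (τ : Fin 6 ⊕ Fin 6 ≃ Fin 12) (A : Matrix (Fin 6) (Fin 6) (ZMod 3))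
    (u : Fin 6 → ZMod 3) : wt (encode τ A u) = hammingNorm u + hammingNorm (u ᵥ* A) := by
  simp only [wt, hammingNorm, Finset.card_filter]
  rw [← τ.sum_comp, Fintype.sum_sum_type]
  simp only [encode, Function.comp_apply, Equiv.symm_apply_apply, Sum.elim_inl, Sum.elim_inr]

theorem transpose_mul_of_mul_transpose {A : Matrix (Fin 6) (Fin 6) (ZMod 3)}
    (hA : A * Aᵀ = -1) : Aᵀ * A = -1 := by
  have h : A * -Aᵀ = 1 := by rw [mul_neg, hA, neg_neg]
  rw [mul_eq_one_comm, neg_mul] at h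
  rw [← h, neg_neg]

theorem isSelfDual_systematicCode (τ : Fin 6 ⊕ Fin 6 ≃ Fin 12)
    {A : Matrix (Fin 6) (Fin 6) (ZMod 3)} (hA : A * Aᵀ = -1) :
    IsSelfDual (systematicCode τ A) := by
  have hA' := transpose_mul_of_mul_transpose hA
  ext y
  simp only [SetLike.mem_coe, Set.mem_ofPred_eq]
  constructor
  · intro hy x hx
    rw [eq_encode hx, eq_encode hy, sum_encode_mul_encode, hA]
    simp [neg_mulVec]
  · intro hy
    have h : (fun i => y (τ (.inl i))) = -(A *ᵥ fun j => y (τ (.inr j))) := by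
      rw [eq_neg_iff_add_eq_zero]
      refine dotProduct_eq_zero _ fun u => ?_
      rw [dotProduct_comm, dotProduct_add, dotProduct_mulVec, ← sum_mul_encode]
      exact hy _ (encode_mem τ A u)
    have h2 : (fun i => y (τ (.inl i))) ᵥ* A = fun j => y (τ (.inr j)) := by
      rw [h, neg_vecMul, ← vecMul_transpose, vecMul_vecMul, hA', vecMul_neg, vecMul_one, neg_neg]
    intro j
    exact (congrFun h2 j).symm

theorem mul_transpose_of_isSelfDual {τ : Fin 6 ⊕ Fin 6 ≃ Fin 12}
    {A : Matrix (Fin 6) (Fin 6) (ZMod 3)} (h : IsSelfDual (systematicCode τ A)) :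
    A * Aᵀ = -1 := by
  have key (u v : Fin 6 → ZMod 3) : u ⬝ᵥ v + u ⬝ᵥ ((A * Aᵀ) *ᵥ v) = 0 := by
    rw [← sum_encode_mul_encode τ]
    have hv : encode τ A v ∈ (systematicCode τ A : Set _) := encode_mem τ A v
    rw [h] at hv
    exact hv _ (encode_mem τ A u)
  rw [eq_neg_iff_add_eq_zero]
  ext i j
  have := key (Pi.single i 1) (Pi.single j 1)
  rw [← dotProduct_add] at this
  simpa [Matrix.one_apply, Pi.single_apply, add_comm, eq_comm] using this

theorem finrank_of_isSelfDual {C : Submodule (ZMod 3) (Fin 12 → ZMod 3)} (hC : IsSelfDual C) :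
    Module.finrank (ZMod 3) C = 6 := by
  have hB : (Matrix.toBilin' (1 : Matrix (Fin 12) (Fin 12) (ZMod 3))).Nondegenerate :=
    Matrix.Nondegenerate.toBilin' (nondegenerate_of_det_ne_zero (by simp))
  have hO : (Matrix.toBilin' (1 : Matrix (Fin 12) (Fin 12) (ZMod 3))).orthogonal C = C := by
    apply SetLike.coe_injective
    rw [hC]
    ext y
    simp [LinearMap.BilinForm.mem_orthogonal_iff, Matrix.toBilin'_apply', dotProduct]
  have h := LinearMap.BilinForm.finrank_orthogonal hB C
  have hle := C.finrank_le
  rw [hO] at h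
  simp only [Module.finrank_fintype_fun_eq_card, Fintype.card_fin] at h hle
  omega

/-- A `6`-dimensional code of length `12` is systematic in some set of coordinates. -/
theorem exists_eq_systematicCode {C : Submodule (ZMod 3) (Fin 12 → ZMod 3)}
    (hC : Module.finrank (ZMod 3) C = 6) : ∃ τ A, C = systematicCode τ A := by
  let φ : Fin 12 → Module.Dual (ZMod 3) C := fun i => LinearMap.proj i ∘ₗ C.subtype
  have hφ : Submodule.span (ZMod 3) (Set.range φ) = ⊤ := by
    have hb := (Pi.basisFun (ZMod 3) (Fin 12)).dualBasis.span_eq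
    have hs := LinearMap.dualMap_surjective_of_injective C.injective_subtype
    rw [← LinearMap.range_eq_top.2 hs, LinearMap.range_eq_map, ← hb, Submodule.map_span,
      ← Set.range_comp]
    congr 2
    ext i x
    simp [φ]
  obtain ⟨κ, a, ha, hspan, hli⟩ := exists_linearIndependent' (ZMod 3) φ
  have : Finite κ := Finite.of_injective a ha
  let b := Module.Basis.mk hli (by rw [hspan, hφ])
  have hκ : Nat.card κ = 6 := by
    rw [← Module.finrank_eq_nat_card_basis b, Subspace.dual_finrank_eq, hC]
  let e : Fin 6 ≃ κ := (Finite.equivFinOfCardEq hκ).symm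
  let f : Fin 6 → Fin 12 := a ∘ e
  have hf : Function.Injective f := ha.comp e.injective
  classical
  have hcard : Fintype.card ((Set.range f)ᶜ : Set (Fin 12)) = 6 := by
    rw [Fintype.card_compl_set, Set.card_range_of_injective hf]; simp
  let τ : Fin 6 ⊕ Fin 6 ≃ Fin 12 :=
    ((Equiv.ofInjective f hf).sumCongr (Fintype.equivFinOfCardEq hcard).symm).trans
      (Equiv.Set.sumCompl (Set.range f))
  have hτ (i : Fin 6) : τ (.inl i) = a (e i) := by simp [τ, f]
  let A : Matrix (Fin 6) (Fin 6) (ZMod 3) := fun i j => b.repr (φ (τ (.inr j))) (e i)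
  have hA (x : C) (j : Fin 6) :
      x.1 (τ (.inr j)) = ∑ i, x.1 (τ (.inl i)) * A i j := by
    have : Fintype κ := Fintype.ofFinite κ
    have h := congrArg (fun g : Module.Dual (ZMod 3) C => g x) (b.sum_repr (φ (τ (.inr j))))
    rw [← e.sum_comp] at h
    simp only [LinearMap.sum_apply, LinearMap.smul_apply, smul_eq_mul] at h
    rw [show x.1 (τ (.inr j)) = φ (τ (.inr j)) x from rfl, ← h]
    refine Finset.sum_congr rfl fun i _ => ?_
    rw [hτ, mul_comm]
    simp [b, φ, A]
  refine ⟨τ, A, le_antisymm (fun x hx j => hA ⟨x, hx⟩ j) fun y hy => ?_⟩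
  let ρ : C →ₗ[ZMod 3] (Fin 6 → ZMod 3) :=
    LinearMap.funLeft (ZMod 3) (ZMod 3) (fun i => τ (.inl i)) ∘ₗ C.subtype
  have hρ : Function.Injective ρ := by
    rw [← LinearMap.ker_eq_bot, LinearMap.ker_eq_bot']
    intro x hx
    have h0 (i : Fin 6) : x.1 (τ (.inl i)) = 0 := congrFun hx i
    ext k
    obtain ⟨s, rfl⟩ := τ.surjective k
    rcases s with i | j
    · simp [h0 i]
    · simp [hA x j, h0]
  obtain ⟨x, hx⟩ := (LinearMap.injective_iff_surjective_of_finrank_eq_finrank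
    (by simp [hC])).1 hρ (fun i => y (τ (.inl i)))
  have hxy : y = x.1 := by
    rw [eq_encode hy, eq_encode (τ := τ) (A := A) (y := x.1) (hA x), ← hx]
    rfl
  rw [hxy]
  exact x.2

theorem _root_.MonomialEquiv.symm {C D : Submodule (ZMod 3) (Fin 12 → ZMod 3)}
    (h : MonomialEquiv C D) : MonomialEquiv D C := by
  obtain ⟨σ, ε, hε, h⟩ := h
  refine ⟨σ.symm, fun i => ε (σ.symm i), fun i => hε _, fun y => ?_⟩
  rw [h]
  simp only [Equiv.symm_apply_apply]
  have hsq (i : Fin 12) : ε i * (ε i * y i) = y i := by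
    rcases hε i with h | h <;> simp [h]
  simp only [hsq]

theorem _root_.MonomialEquiv.trans {C D E : Submodule (ZMod 3) (Fin 12 → ZMod 3)}
    (h : MonomialEquiv C D) (h' : MonomialEquiv D E) : MonomialEquiv C E := by
  obtain ⟨σ, ε, hε, h⟩ := h
  obtain ⟨σ', ε', hε', h'⟩ := h'
  refine ⟨σ.trans σ', fun i => ε i * ε' (σ i), fun i => ?_, fun y => ?_⟩
  · rcases hε i with h | h <;> rcases hε' (σ i) with h' | h' <;> simp [h, h']
  · rw [h', h]
    simp only [Equiv.trans_apply, mul_assoc]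

theorem eq_one_or_eq_neg_one_of_ne_zero : ∀ {a : ZMod 3}, a ≠ 0 → a = 1 ∨ a = -1 := by
  decide

theorem mul_self_of_ne_zero : ∀ {a : ZMod 3}, a ≠ 0 → a * a = 1 := by
  decide

theorem monomialEquiv_systematicCode (τ τ' : Fin 6 ⊕ Fin 6 ≃ Fin 12)
    {A B : Matrix (Fin 6) (Fin 6) (ZMod 3)} (p q : Equiv.Perm (Fin 6)) {r c : Fin 6 → ZMod 3}
    (hr : ∀ i, r i ≠ 0) (hc : ∀ j, c j ≠ 0) (h : ∀ i j, B i j = r i * A (p i) (q j) * c j) :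
    MonomialEquiv (systematicCode τ A) (systematicCode τ' B) := by
  refine ⟨τ.symm.trans ((p.sumCongr q).symm.trans τ'),
    fun k => Sum.elim r c ((p.sumCongr q).symm (τ.symm k)), fun k => ?_, fun y => ?_⟩
  · apply eq_one_or_eq_neg_one_of_ne_zero
    beta_reduce
    rcases (p.sumCongr q).symm (τ.symm k) with i | j
    · exact hr i
    · exact hc j
  · rw [mem_systematicCode, mem_systematicCode (A := A),
      ← q.forall_congr_right (q := fun j => _ = ∑ i, _ * A i j)]
    refine forall_congr' fun j => ?_
    rw [← Equiv.sum_comp p (fun i => _ * A i (q j))]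
    simp only [Equiv.trans_apply, Equiv.symm_apply_apply, Equiv.sumCongr_symm,
      Equiv.sumCongr_apply, Sum.map_inl, Sum.map_inr, Sum.elim_inl, Sum.elim_inr]
    have hs : ∑ i, y (τ' (.inl i)) * B i j =
        c j * ∑ i, r i * y (τ' (.inl i)) * A (p i) (q j) := by
      rw [Finset.mul_sum]
      refine Finset.sum_congr rfl fun i _ => ?_
      rw [h]; ring
    rw [hs]
    constructor
    · intro hy
      rw [hy, ← mul_assoc, mul_self_of_ne_zero (hc j), one_mul]
    · intro hy
      rw [← hy, ← mul_assoc, mul_self_of_ne_zero (hc j), one_mul]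

theorem exists_zero_iff {u : Fin 6 → ZMod 3} (hu : u ⬝ᵥ u = -1) (h2 : hammingNorm u ≠ 2) :
    ∃ j, ∀ k, u k = 0 ↔ k = j := by
  have hn : ((hammingNorm u : ℕ) : ZMod 3) = (2 : ℕ) := by
    rw [hammingNorm, Finset.card_filter, Nat.cast_sum]
    trans u ⬝ᵥ u
    · refine Finset.sum_congr rfl fun i _ => ?_
      by_cases h : u i = 0
      · simp [h]
      · simp [h, mul_self_of_ne_zero h]
    · rw [hu]; decide
  rw [ZMod.natCast_eq_natCast_iff] at hn
  have hle : hammingNorm u ≤ 6 := hammingNorm_le_card_fintype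
  have h5 : hammingNorm u = 5 := by
    unfold Nat.ModEq at hn
    omega
  have hz : (Finset.univ.filter (fun k => u k = 0)).card = 1 := by
    have := Finset.card_filter_add_card_filter_not (s := Finset.univ) (fun k : Fin 6 => u k = 0)
    simp only [hammingNorm] at h5
    simp only [Finset.card_univ, Fintype.card_fin] at this
    have h5' : (Finset.univ.filter (fun k => ¬ u k = 0)).card = 5 := h5
    omega
  obtain ⟨j, hj⟩ := Finset.card_eq_one.1 hz
  refine ⟨j, fun k => ?_⟩
  simpa using Finset.ext_iff.1 hj k

/-- The six words of length `4` with nonzero entries that sum to zero. -/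
def balancedWord : Fin 6 → Fin 4 → ZMod 3 :=
  ![![1, 1, -1, -1], ![1, -1, 1, -1], ![1, -1, -1, 1],
    ![-1, 1, 1, -1], ![-1, 1, -1, 1], ![-1, -1, 1, 1]]

theorem exists_eq_balancedWord : ∀ a : ZMod 3, a ≠ 0 → ∀ b : ZMod 3, b ≠ 0 →
    ∀ c : ZMod 3, c ≠ 0 → ∀ d : ZMod 3, d ≠ 0 → a + b + c + d = 0 →
    ∃ k, balancedWord k = ![a, b, c, d] := by
  decide +kernel

/-- A row of a `5 × 5` matrix with zero diagonal: the `k`-th balanced word with a zero inserted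
in position `i`. -/
def balancedRow (i : Fin 5) (k : Fin 6) : Fin 5 → ZMod 3 :=
  i.insertNth 0 (balancedWord k)

/-- The `±1` adjacency matrix of the pentagon. -/
def pentagonMatrix : Fin 5 → Fin 5 → ZMod 3 :=
  ![![0, 1, -1, -1, 1],
    ![1, 0, 1, -1, -1],
    ![-1, 1, 0, 1, -1],
    ![-1, -1, 1, 0, 1],
    ![1, -1, -1, 1, 0]]

theorem exists_perm_balancedRow : ∀ k0 k1,
    balancedRow 0 k0 ⬝ᵥ balancedRow 1 k1 = -1 → ∀ k2,
    balancedRow 0 k0 ⬝ᵥ balancedRow 2 k2 = -1 ∧ balancedRow 1 k1 ⬝ᵥ balancedRow 2 k2 = -1 → ∀ k3,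
    balancedRow 0 k0 ⬝ᵥ balancedRow 3 k3 = -1 ∧ balancedRow 1 k1 ⬝ᵥ balancedRow 3 k3 = -1 ∧
      balancedRow 2 k2 ⬝ᵥ balancedRow 3 k3 = -1 → ∀ k4,
    balancedRow 0 k0 ⬝ᵥ balancedRow 4 k4 = -1 ∧ balancedRow 1 k1 ⬝ᵥ balancedRow 4 k4 = -1 ∧
      balancedRow 2 k2 ⬝ᵥ balancedRow 4 k4 = -1 ∧ balancedRow 3 k3 ⬝ᵥ balancedRow 4 k4 = -1 →
    ∃ π : Equiv.Perm (Fin 5), ∀ i j,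
      balancedRow (π i) (![k0, k1, k2, k3, k4] (π i)) (π j) = pentagonMatrix i j := by
  decide +kernel

theorem exists_perm_eq_pentagonMatrix {B : Matrix (Fin 5) (Fin 5) (ZMod 3)}
    (hdiag : ∀ i, B i i = 0) (hoff : ∀ i j, i ≠ j → B i j ≠ 0) (hsum : ∀ i, ∑ j, B i j = 0)
    (horth : ∀ i k, i ≠ k → B i ⬝ᵥ B k = -1) :
    ∃ π : Equiv.Perm (Fin 5), ∀ i j, B (π i) (π j) = pentagonMatrix i j := by
  have hrow (i : Fin 5) : ∃ k, B i = balancedRow i k := by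
    have hs := hsum i
    rw [Fin.sum_univ_succAbove _ i, hdiag, zero_add, Fin.sum_univ_four] at hs
    have hne (j : Fin 4) : B i (i.succAbove j) ≠ 0 := hoff _ _ (Fin.succAbove_ne i j).symm
    obtain ⟨k, hk⟩ := exists_eq_balancedWord _ (hne 0) _ (hne 1) _ (hne 2) _ (hne 3) hs
    refine ⟨k, ?_⟩
    rw [balancedRow, hk, Fin.eq_insertNth_iff]
    refine ⟨hdiag i, ?_⟩
    ext j
    fin_cases j <;> rfl
  choose k hk using hrow
  simp only [hk] at horth
  obtain ⟨π, hπ⟩ := exists_perm_balancedRow (k 0) (k 1) (horth 0 1 (by decide)) (k 2)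
    ⟨horth 0 2 (by decide), horth 1 2 (by decide)⟩ (k 3)
    ⟨horth 0 3 (by decide), horth 1 3 (by decide), horth 2 3 (by decide)⟩ (k 4)
    ⟨horth 0 4 (by decide), horth 1 4 (by decide), horth 2 4 (by decide), horth 3 4 (by decide)⟩
  have hvec : ![k 0, k 1, k 2, k 3, k 4] = k := by
    ext i
    fin_cases i <;> rfl
  rw [hvec] at hπ
  exact ⟨π, fun i j => by rw [hk, hπ]⟩

/-- The bordered pentagon matrix, the right half of the standard generator matrix of the ternary
Golay code. -/
def golayMatrix : Matrix (Fin 6) (Fin 6) (ZMod 3) :=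
  Matrix.of (Fin.cons (Fin.cons 0 1) fun i => Fin.cons 1 (pentagonMatrix i))

theorem golayMatrix_mul_transpose : golayMatrix * golayMatrixᵀ = -1 := by
  decide +kernel

theorem hammingNorm_add_ne_three : ∀ u : Fin 6 → ZMod 3,
    hammingNorm u + hammingNorm (u ᵥ* golayMatrix) ≠ 3 := by
  decide +kernel

theorem exists_eq_golayMatrix {A : Matrix (Fin 6) (Fin 6) (ZMod 3)} (hA : A * Aᵀ = -1)
    (hrow : ∀ i, ∃ j, ∀ k, A i k = 0 ↔ k = j) (hcol : ∀ j, ∃ i, ∀ k, A k j = 0 ↔ k = i) :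
    ∃ (p q : Equiv.Perm (Fin 6)) (r c : Fin 6 → ZMod 3), (∀ i, r i ≠ 0) ∧ (∀ j, c j ≠ 0) ∧
      ∀ i j, golayMatrix i j = r i * A (p i) (q j) * c j := by
  choose z hz using hrow
  choose z' hz' using hcol
  let ζ : Equiv.Perm (Fin 6) :=
    ⟨z, z', fun i => ((hz' (z i) i).1 ((hz i (z i)).2 rfl)).symm,
      fun j => ((hz (z' j) j).1 ((hz' j (z' j)).2 rfl)).symm⟩
  have hζ (i j : Fin 6) : A i (ζ j) = 0 ↔ i = j := by
    rw [hz, eq_comm]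
    exact ζ.injective.eq_iff
  let r : Fin 6 → ZMod 3 := fun i => if i = 0 then 1 else A i (ζ 0)
  let c : Fin 6 → ZMod 3 := fun j => if j = 0 then 1 else A 0 (ζ j)
  have hr (i : Fin 6) : r i ≠ 0 := by
    by_cases h : i = 0 <;> simp [r, h, hζ]
  have hc (j : Fin 6) : c j ≠ 0 := by
    by_cases h : j = 0 <;> simp [c, h, hζ, eq_comm]
  let M : Matrix (Fin 6) (Fin 6) (ZMod 3) := fun i j => r i * A i (ζ j) * c j
  have hM (i j : Fin 6) : M i j = 0 ↔ i = j := by simp [M, hr, hc, hζ]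
  have hM0 (j : Fin 5) : M 0 j.succ = 1 := by
    have h : A 0 (ζ j.succ) ≠ 0 := by simp [hζ, (Fin.succ_ne_zero j).symm]
    simp [M, r, c, mul_self_of_ne_zero h]
  have hM0' (i : Fin 5) : M i.succ 0 = 1 := by
    have h : A i.succ (ζ 0) ≠ 0 := by simp [hζ]
    simp [M, r, c, mul_self_of_ne_zero h]
  have horth (i k : Fin 6) (hik : i ≠ k) : ∑ j, M i j * M k j = 0 := by
    have h : ∑ j, A i j * A k j = 0 := by
      have := congrFun (congrFun hA i) k
      simpa [Matrix.mul_apply, hik] using this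
    rw [← Equiv.sum_comp ζ] at h
    trans r i * r k * ∑ j, A i (ζ j) * A k (ζ j)
    · rw [Finset.mul_sum]
      refine Finset.sum_congr rfl fun j _ => ?_
      simp only [M]
      linear_combination (r i * r k * A i (ζ j) * A k (ζ j)) * mul_self_of_ne_zero (hc j)
    · rw [h, mul_zero]
  obtain ⟨π, hπ⟩ := exists_perm_eq_pentagonMatrix (B := fun i j => M i.succ j.succ)
    (fun i => (hM _ _).2 rfl) (fun i j hij => by simpa [hM] using hij)
    (fun i => by
      have := horth 0 i.succ (Fin.succ_ne_zero i).symm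
      simpa [Fin.sum_univ_succ (n := 5), hM0, (hM 0 0).2 rfl] using this)
    (fun i k hik => by
      have := horth i.succ k.succ (by simpa using hik)
      rw [Fin.sum_univ_succ, hM0', hM0', mul_one] at this
      exact eq_neg_of_add_eq_zero_right this)
  let p : Equiv.Perm (Fin 6) := Equiv.Perm.decomposeFin.symm (0, π)
  refine ⟨p, p.trans ζ, r ∘ p, c ∘ p, fun i => hr _, fun j => hc _, fun i j => ?_⟩
  change golayMatrix i j = M (p i) (p j)
  refine Fin.cases ?_ (fun i => ?_) i <;> refine Fin.cases ?_ (fun j => ?_) j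
  · simp [golayMatrix, p, (hM 0 0).2 rfl]
  · simp [golayMatrix, p, hM0]
  · simp [golayMatrix, p, hM0']
  · simpa [golayMatrix, p] using (hπ i j).symm

theorem monomialEquiv_golay {C : Submodule (ZMod 3) (Fin 12 → ZMod 3)} (hC : IsSelfDual C)
    (hC3 : ∀ x ∈ C, wt x ≠ 3) :
    MonomialEquiv C (systematicCode finSumFinEquiv golayMatrix) := by
  obtain ⟨τ, A, rfl⟩ := exists_eq_systematicCode (finrank_of_isSelfDual hC)
  have hA := mul_transpose_of_isSelfDual hC
  have hA' : Aᵀ * A = -1 := transpose_mul_of_mul_transpose hA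
  have h3 (u : Fin 6 → ZMod 3) : hammingNorm u + hammingNorm (u ᵥ* A) ≠ 3 := by
    rw [← wt_encode τ]
    exact hC3 _ (encode_mem τ A u)
  have hsingle (i : Fin 6) : hammingNorm (Pi.single i 1 : Fin 6 → ZMod 3) = 1 := by
    revert i; decide +kernel
  have hrow (i : Fin 6) : ∃ j, ∀ k, A i k = 0 ↔ k = j := by
    refine exists_zero_iff ?_ fun h => h3 (Pi.single i 1) ?_
    · simpa [Matrix.mul_apply, dotProduct] using congrFun (congrFun hA i) i
    · rw [hsingle, single_one_vecMul]
      exact congrArg (1 + ·) h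
  have hcol (j : Fin 6) : ∃ i, ∀ k, A k j = 0 ↔ k = i := by
    refine exists_zero_iff (u := Aᵀ j) ?_ fun h => h3 (-Aᵀ j) ?_
    · simpa [Matrix.mul_apply, dotProduct] using congrFun (congrFun hA' j) j
    · have hv : -Aᵀ j ᵥ* A = Pi.single j 1 := by
        ext k
        have := congrFun (congrFun hA' j) k
        rw [neg_vecMul, Pi.neg_apply, neg_eq_iff_eq_neg]
        simpa [Matrix.mul_apply, vecMul, dotProduct, Matrix.one_apply, Pi.single_apply,
          eq_comm] using this
      have hn : hammingNorm (-Aᵀ j) = hammingNorm (Aᵀ j) := by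
        simp only [hammingNorm, Pi.neg_apply, neg_ne_zero]
      rw [hv, hsingle, hn, h]
  obtain ⟨p, q, r, c, hr, hc, h⟩ := exists_eq_golayMatrix hA hrow hcol
  exact monomialEquiv_systematicCode _ _ p q hr hc h

end TernaryGolay

/-- There is a self-dual ternary code of length 12 with no codewords of Hamming
weight 3 (the ternary Golay code), and it is unique up to monomial equivalence. -/
theorem stmt19 :
    (∃ C : Submodule (ZMod 3) (Fin 12 → ZMod 3),
      IsSelfDual C ∧ ∀ x ∈ C, wt x ≠ 3) ∧
    ∀ C D : Submodule (ZMod 3) (Fin 12 → ZMod 3),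
      IsSelfDual C → (∀ x ∈ C, wt x ≠ 3) →
      IsSelfDual D → (∀ x ∈ D, wt x ≠ 3) →
      MonomialEquiv C D := by
  refine ⟨⟨TernaryGolay.systematicCode finSumFinEquiv TernaryGolay.golayMatrix,
    TernaryGolay.isSelfDual_systematicCode _ TernaryGolay.golayMatrix_mul_transpose,
    fun x hx => ?_⟩, fun C D hC hC3 hD hD3 => ?_⟩
  · rw [TernaryGolay.eq_encode hx, TernaryGolay.wt_encode]
    exact TernaryGolay.hammingNorm_add_ne_three _
  · exact (TernaryGolay.monomialEquiv_golay hC hC3).trans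
      (TernaryGolay.monomialEquiv_golay hD hD3).symm
end
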